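/- arXiv:2411.13371 — 6 statements merged into one kernel-verified Lean document; each statement's English description precedes it below -/
import Mathlib

section
/- Let γ be a dotted composition with column decomposition γ = α^{(1)} ⊙ α^{(2)} ⊙ ⋯ ⊙ α^{(ℓ)}, i.e. each α^{(i)} is a column, the first entry of α^{(i)} is undotted for all i ≥ 2, and the last entry of α^{(i)} is undotted for all i ≤ ℓ−1. Then S(L_γ) = (−1)^{sign(γ)} S(L_{α^{(ℓ)}}) • S(L_{α^{(ℓ−1)}}) • ⋯ • S(L_{α^{(1)}}), where sign(γ) = Σ_{1≤i<j≤ℓ} m_{α^{(i)}} m_{α^{(j)}}. -/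
/-! ## Dotted compositions -/

/-- An entry of a dotted composition: either an undotted positive integer
or a dotted nonnegative integer. -/
inductive DEntry : Type
  | undot : ℕ+ → DEntry
  | dot : ℕ → DEntry
  deriving DecidableEq

/-- A dotted composition is a finite sequence of dotted-composition entries. -/
abbrev DComp : Type := List DEntry

namespace DEntry

/-- Is the entry dotted? -/
def isDot : DEntry → Bool
  | undot _ => false
  | dot _ => true

/-- The numerical value of an entry. -/
def val : DEntry → ℕ
  | undot a => a
  | dot a => a

/-- The sum of two entries, defined when not both are dotted; the sum is dotted
iff one of the two entries is dotted. -/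
def add? : DEntry → DEntry → Option DEntry
  | undot a, undot b => some (undot (a + b))
  | undot a, dot b => some (dot (a + b))
  | dot a, undot b => some (dot (a + b))
  | dot _, dot _ => none

end DEntry

namespace DComp

/-- The total degree `|α|`. -/
def deg (α : DComp) : ℕ := (α.map DEntry.val).sum

/-- The fermionic degree `m_α`: the number of dotted entries. -/
def fdeg (α : DComp) : ℕ := (α.filter (fun e => e.isDot)).length

/-- Cover relation for the order `⪯`: `α` covers `β` when `α` is obtained from `β`
by replacing two adjacent undotted parts of `β` by their (undotted) sum. -/
def StrongCover (β α : DComp) : Prop :=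
  ∃ (l r : DComp) (a b : ℕ+),
    β = l ++ DEntry.undot a :: DEntry.undot b :: r ∧
    α = l ++ DEntry.undot (a + b) :: r

/-- `StrongLe β α` means `β ⪯ α` (β strongly refines α): the reflexive-transitive
closure of the cover relation `StrongCover`. -/
def StrongLe : DComp → DComp → Prop := Relation.ReflTransGen StrongCover

/-- Cover relation for the order `⊴`: `α` covers `β` when `α` is obtained from `β`
by replacing two adjacent parts of `β`, at most one of which is dotted, by their sum
(dotted iff one of the two parts was dotted). -/
def WeakCover (β α : DComp) : Prop :=
  ∃ (l r : DComp) (x y z : DEntry),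
    β = l ++ x :: y :: r ∧ DEntry.add? x y = some z ∧ α = l ++ z :: r

/-- `WeakLe β α` means `β ⊴ α` (β weakly refines α). -/
def WeakLe : DComp → DComp → Prop := Relation.ReflTransGen WeakCover

/-- The near concatenation `α ⊙ β`, defined when `α` and `β` are nonempty and
not both the last entry of `α` and the first entry of `β` are dotted. -/
def nearConcat (α β : DComp) : Option DComp :=
  match β with
  | [] => none
  | y :: ys =>
    match α.getLast? with
    | none => none
    | some x => (DEntry.add? x y).map (fun z => α.dropLast ++ z :: ys)

end DComp

/-! ## Quasisymmetric functions in superspace as a free `ℚ`-module -/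

/-- `sQSym`: the free `ℚ`-module with basis indexed by dotted compositions. -/
abbrev sQSym : Type := DComp →₀ ℚ

/-- The monomial quasisymmetric function in superspace `M_α`, as a basis element. -/
noncomputable def Mono (α : DComp) : sQSym := Finsupp.single α 1

/-- The fundamental quasisymmetric function in superspace `L_α = ∑_{β ⪯ α} M_β`. -/
noncomputable def Fund (α : DComp) : sQSym := ∑ᶠ β ∈ {β | DComp.StrongLe β α}, Mono β

/-- The bilinear product `•` with `M_α • M_β = M_{α·β}` (concatenation). -/
noncomputable def cdot (F G : sQSym) : sQSym :=
  F.sum fun α a => G.sum fun β b => (a * b) • Mono (α ++ β)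

/-- The bilinear product `⊙` with `M_α ⊙ M_β = M_{α⊙β}` when the near concatenation
is defined, and `M_α ⊙ M_β = 0` otherwise. -/
noncomputable def odot (F G : sQSym) : sQSym :=
  F.sum fun α a => G.sum fun β b =>
    match DComp.nearConcat α β with
    | some γ => (a * b) • Mono γ
    | none => 0

/-- The antipode `S`, the `ℚ`-linear map determined by
`S(M_α) = (-1)^{ℓ(α) + binom(m_α, 2)} ∑_{γ ⊵ Rev(α)} M_γ`. -/
noncomputable def antipode (F : sQSym) : sQSym :=
  F.sum fun α c =>
    (c * (-1 : ℚ) ^ (α.length + Nat.choose (DComp.fdeg α) 2)) •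
      ∑ᶠ γ ∈ {γ | DComp.WeakLe α.reverse γ}, Mono γ

/-- A dotted composition is a column if every undotted entry equals `1`. -/
def IsColumn (α : DComp) : Prop := ∀ e ∈ α, e.isDot = true ∨ e = DEntry.undot 1

/-- Iterated near concatenation, taken left to right, of a list of dotted
compositions (partial). -/
def nearConcatFold : List DComp → Option DComp
  | [] => none
  | a :: rest => rest.foldl (fun acc b => acc.bind fun x => DComp.nearConcat x b) (some a)


namespace DC

open DEntry DComp

theorem add?_assoc (x y z : DEntry) :
    ((add? x y).bind fun w => add? w z) = ((add? y z).bind fun w => add? x w) := by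
  cases x <;> cases y <;> cases z <;> simp [add?, add_assoc]

theorem add?_inj {x y y' z : DEntry} (h : add? x y = some z) (h' : add? x y' = some z) :
    y = y' := by
  cases x <;> cases y <;> cases y' <;> simp [add?] at h h' <;> subst h <;> simp_all

theorem add?_ne {x y : DEntry} : add? x y ≠ some x := by
  cases x <;> cases y <;> simp [add?]
  intro h
  have := congrArg PNat.val h
  have h2 := PNat.pos ‹ℕ+›
  rename_i a b
  have h1 := b.pos
  simp at this

theorem nearConcat_snoc_cons (l r : DComp) (x y : DEntry) :
    nearConcat (l ++ [x]) (y :: r) = (add? x y).map (fun z => l ++ z :: r) := by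
  simp [nearConcat]

@[simp] theorem nearConcat_nil_left (r : DComp) : nearConcat [] r = none := by
  cases r <;> simp [nearConcat]

@[simp] theorem nearConcat_nil_right (r : DComp) : nearConcat r [] = none := by
  simp [nearConcat]

theorem snoc_cases (l : DComp) : l = [] ∨ ∃ l' x, l = l' ++ [x] := by
  rcases List.eq_nil_or_concat l with h | ⟨a, b, h⟩
  · exact Or.inl h
  · exact Or.inr ⟨a, b, by simpa using h⟩

/-- near concatenation as an element. -/
noncomputable def ncM (α β : DComp) : sQSym := (nearConcat α β).elim 0 Mono

noncomputable def cL : sQSym →ₗ[ℚ] sQSym →ₗ[ℚ] sQSym :=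
  Finsupp.lift _ ℚ _ fun α => Finsupp.lift _ ℚ _ fun β => Mono (α ++ β)

noncomputable def oL : sQSym →ₗ[ℚ] sQSym →ₗ[ℚ] sQSym :=
  Finsupp.lift _ ℚ _ fun α => Finsupp.lift _ ℚ _ fun β => ncM α β

noncomputable def T (α : DComp) : sQSym := ∑ᶠ γ ∈ {γ | WeakLe α γ}, Mono γ

noncomputable def sg (α : DComp) : ℚ := (-1 : ℚ) ^ (α.length + Nat.choose (fdeg α) 2)

noncomputable def aL : sQSym →ₗ[ℚ] sQSym :=
  Finsupp.lift _ ℚ _ fun α => sg α • T α.reverse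

theorem cdot_eq (F G : sQSym) : cdot F G = cL F G := by
  simp only [cdot, cL, Finsupp.lift_apply, Finsupp.sum, LinearMap.sum_apply, LinearMap.smul_apply,
    Finset.smul_sum, smul_smul]

theorem antipode_eq (F : sQSym) : antipode F = aL F := by
  simp only [antipode, aL, Finsupp.lift_apply, Finsupp.sum, smul_smul, sg, T]

@[simp] theorem cL_mono (α β : DComp) : cL (Mono α) (Mono β) = Mono (α ++ β) := by
  simp [cL, Mono]

@[simp] theorem oL_mono (α β : DComp) : oL (Mono α) (Mono β) = ncM α β := by
  simp [oL, Mono]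

@[simp] theorem aL_mono (α : DComp) : aL (Mono α) = sg α • T α.reverse := by
  simp [aL, Mono]

@[elab_as_elim]
theorem ind {p : sQSym → Prop} (F : sQSym) (h0 : p 0) (ha : ∀ F G, p F → p G → p (F + G))
    (hs : ∀ (c : ℚ) F, p F → p (c • F)) (hm : ∀ α, p (Mono α)) : p F := by
  induction F using Finsupp.induction_linear with
  | zero => exact h0
  | add F G hF hG => exact ha _ _ hF hG
  | single a c =>
    have : Finsupp.single a c = c • Mono a := by simp [Mono]
    rw [this]; exact hs _ _ (hm a)

/-- nonempty span -/
noncomputable def NE : Submodule ℚ sQSym :=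
  Submodule.span ℚ (Set.range fun p : DEntry × DComp => Mono (p.1 :: p.2))

theorem mono_NE (x : DEntry) (l : DComp) : Mono (x :: l) ∈ NE :=
  Submodule.subset_span ⟨(x, l), rfl⟩

theorem mono_NE' {l : DComp} (h : l ≠ []) : Mono l ∈ NE := by
  cases l with
  | nil => exact absurd rfl h
  | cons x l => exact mono_NE x l

@[elab_as_elim]
theorem indNE {p : sQSym → Prop} (F : sQSym) (hF : F ∈ NE) (h0 : p 0)
    (ha : ∀ F G, p F → p G → p (F + G))
    (hs : ∀ (c : ℚ) F, p F → p (c • F)) (hm : ∀ α, α ≠ [] → p (Mono α)) : p F := by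
  induction hF using Submodule.span_induction with
  | mem x h => obtain ⟨p, rfl⟩ := h; exact hm _ (by simp)
  | zero => exact h0
  | add F G _ _ hF hG => exact ha _ _ hF hG
  | smul c F _ h => exact hs _ _ h

theorem cc (F G H : sQSym) : cL (cL F G) H = cL F (cL G H) := by
  refine ind F (by simp) (by intros; simp_all) (by intros; simp_all) fun α => ?_
  refine ind G (by simp) (by intros; simp_all) (by intros; simp_all) fun β => ?_
  refine ind H (by simp) (by intros; simp_all) (by intros; simp_all) fun γ => ?_
  simp

theorem co (F G H : sQSym) (hG : G ∈ NE) : oL (cL F G) H = cL F (oL G H) := by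
  refine ind F (by simp) (by intros; simp_all) (by intros; simp_all) fun α => ?_
  refine indNE G hG (by simp) (by intros; simp_all) (by intros; simp_all) fun β hb => ?_
  refine ind H (by simp) (by intros; simp_all) (by intros; simp_all) fun γ => ?_
  obtain rfl | ⟨b, x, rfl⟩ := snoc_cases β
  · simp at hb
  cases γ with
  | nil => simp [ncM]
  | cons y r =>
    rw [cL_mono, oL_mono, oL_mono, ← List.append_assoc]
    simp only [ncM, nearConcat_snoc_cons]
    cases add? x y <;> simp

theorem oc (F G H : sQSym) (hG : G ∈ NE) : cL (oL F G) H = oL F (cL G H) := by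
  refine ind F (by simp) (by intros; simp_all) (by intros; simp_all) fun α => ?_
  refine indNE G hG (by simp) (by intros; simp_all) (by intros; simp_all) fun β hb => ?_
  refine ind H (by simp) (by intros; simp_all) (by intros; simp_all) fun γ => ?_
  obtain rfl | ⟨b, x, rfl⟩ := snoc_cases α
  · simp [ncM]
  cases β with
  | nil => simp at hb
  | cons y r =>
    rw [cL_mono, oL_mono, oL_mono]
    simp only [ncM, nearConcat_snoc_cons, List.cons_append]
    cases add? x y <;> simp

theorem oo (F G H : sQSym) : oL (oL F G) H = oL F (oL G H) := by
  refine ind F (by simp) (by intros; simp_all) (by intros; simp_all) fun α => ?_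
  refine ind G (by simp) (by intros; simp_all) (by intros; simp_all) fun β => ?_
  refine ind H (by simp) (by intros; simp_all) (by intros; simp_all) fun γ => ?_
  rw [oL_mono, oL_mono]
  obtain rfl | ⟨a, x, rfl⟩ := snoc_cases α
  · simp only [ncM, nearConcat_nil_left]
    cases nearConcat β γ <;> simp [ncM]
  cases γ with
  | nil =>
    simp only [ncM, nearConcat_nil_right]
    cases nearConcat (a ++ [x]) β <;> simp [ncM]
  | cons z r =>
    cases β with
    | nil => simp [ncM]
    | cons y b =>
      obtain rfl | ⟨b, y', rfl⟩ := snoc_cases b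
      · have h1 := nearConcat_snoc_cons [] r y z
        have h2 := add?_assoc x y z
        simp only [List.nil_append] at h1
        simp only [ncM, nearConcat_snoc_cons, h1]
        cases h : add? x y <;> cases h' : add? y z <;> rw [h, h'] at h2 <;>
          simp only [Option.bind_some, Option.bind_none] at h2 <;>
          first
          | simp [ncM, nearConcat_snoc_cons, h2]; done
          | simp [ncM, nearConcat_snoc_cons, ← h2]
      · have h1 := nearConcat_snoc_cons (y :: b) r y' z
        simp only [List.cons_append] at h1
        simp only [ncM, nearConcat_snoc_cons, h1]
        cases h : add? x y with
        | none => cases h' : add? y' z <;> simp_all [ncM, nearConcat_snoc_cons]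
        | some v =>
          have h3 := nearConcat_snoc_cons (a ++ v :: b) r y' z
          simp only [List.append_assoc, List.cons_append] at h3
          cases h' : add? y' z <;> simp_all [ncM, nearConcat_snoc_cons]

@[simp] theorem cL_one_right (F : sQSym) : cL F (Mono []) = F := by
  refine ind F (by simp) (by intros; simp_all) (by intros; simp_all) fun α => ?_
  simp

theorem cL_NE_left {F : sQSym} (G : sQSym) (hF : F ∈ NE) : cL F G ∈ NE := by
  refine indNE F hF (by simp) (fun _ _ h h' => by simpa using NE.add_mem h h')
    (fun c _ h => by simpa using NE.smul_mem c h) fun α h => ?_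
  refine ind G (by simp) (fun _ _ h h' => by simpa using NE.add_mem h h')
    (fun c _ h => by simpa using NE.smul_mem c h) fun β => ?_
  rw [cL_mono]; exact mono_NE' (by simp [h])

theorem oL_NE (F G : sQSym) : oL F G ∈ NE := by
  refine ind F (by simp) (fun _ _ h h' => by simpa using NE.add_mem h h')
    (fun c _ h => by simpa using NE.smul_mem c h) fun α => ?_
  refine ind G (by simp) (fun _ _ h h' => by simpa using NE.add_mem h h')
    (fun c _ h => by simpa using NE.smul_mem c h) fun β => ?_
  rw [oL_mono]
  obtain rfl | ⟨a, x, rfl⟩ := snoc_cases α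
  · simp [ncM]
  cases β with
  | nil => simp [ncM]
  | cons z r =>
    simp only [ncM, nearConcat_snoc_cons]
    cases add? x z
    · simp
    · exact mono_NE' (by simp)

/-- The set obtained by prepending or merging x. -/
def stepS (x : DEntry) (A : Set DComp) : Set DComp :=
  (fun δ => x :: δ) '' A ∪ {γ | ∃ y z t, y :: t ∈ A ∧ add? x y = some z ∧ γ = z :: t}

noncomputable def SM (A : Set DComp) : sQSym := ∑ᶠ γ ∈ A, Mono γ

theorem stepS_spec (x : DEntry) (A : Set DComp) (hA : A.Finite) :
    (stepS x A).Finite ∧ SM (stepS x A) = cL (Mono [x]) (SM A) + oL (Mono [x]) (SM A) := by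
  induction A, hA using Set.Finite.induction_on with
  | empty => simp [stepS, SM]
  | @insert δ A hδ hA ih =>
    obtain ⟨hf, ih⟩ := ih
    have hs : SM (insert δ A) = Mono δ + SM A := finsum_mem_insert _ hδ hA
    have hx : x :: δ ∉ stepS x A := by
      rintro (⟨d, hd, h⟩ | ⟨y, z, t, h1, h2, h3⟩)
      · simp at h; subst h; exact hδ hd
      · simp at h3; obtain ⟨rfl, rfl⟩ := h3; exact add?_ne h2
    rw [hs]
    have key : (∀ y t z, δ = y :: t → add? x y ≠ some z) ∨
        ∃ y t z, δ = y :: t ∧ add? x y = some z := by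
      by_cases h : ∃ y t z, δ = y :: t ∧ add? x y = some z
      · exact Or.inr h
      · left; intro y t z h1 h2; exact h ⟨y, t, z, h1, h2⟩
    rcases key with h | ⟨y, t, z, rfl, hz⟩
    · have e : stepS x (insert δ A) = insert (x :: δ) (stepS x A) := by
        ext γ
        simp only [stepS, Set.image_insert_eq, Set.mem_union, Set.mem_insert_iff, Set.mem_ofPred_eq]
        constructor
        · rintro ((h | h) | ⟨y, z, t, h1 | h1, h2, h3⟩)
          · exact Or.inl h
          · exact Or.inr (Or.inl h)
          · exact absurd h2 (h y t z h1.symm)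
          · exact Or.inr (Or.inr ⟨y, z, t, h1, h2, h3⟩)
        · rintro (h | h | ⟨y, z, t, h1, h2, h3⟩)
          · exact Or.inl (Or.inl h)
          · exact Or.inl (Or.inr h)
          · exact Or.inr ⟨y, z, t, Or.inr h1, h2, h3⟩
      have e2 : ncM [x] δ = 0 := by
        cases δ with
        | nil => simp [ncM]
        | cons y t =>
          have := nearConcat_snoc_cons [] t x y
          simp only [List.nil_append] at this
          simp only [ncM, this]
          cases h' : add? x y with
          | none => simp
          | some z => exact absurd h' (h y t z rfl)
      rw [e]
      refine ⟨hf.insert _, ?_⟩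
      have : SM (insert (x :: δ) (stepS x A)) = Mono (x :: δ) + SM (stepS x A) :=
        finsum_mem_insert _ hx hf
      rw [this, ih]
      simp only [map_add, cL_mono, oL_mono, e2, List.singleton_append]
      abel
    · have e : stepS x (insert (y :: t) A) = insert (x :: y :: t) (insert (z :: t) (stepS x A)) := by
        ext γ
        simp only [stepS, Set.image_insert_eq, Set.mem_union, Set.mem_insert_iff, Set.mem_ofPred_eq]
        constructor
        · rintro ((h | h) | ⟨y', z', t', h1 | h1, h2, h3⟩)
          · exact Or.inl h
          · exact Or.inr (Or.inr (Or.inl h))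
          · simp at h1
            obtain ⟨rfl, rfl⟩ := h1
            rw [hz] at h2
            simp at h2
            subst h2
            exact Or.inr (Or.inl h3)
          · exact Or.inr (Or.inr (Or.inr ⟨y', z', t', h1, h2, h3⟩))
        · rintro (h | h | h | ⟨y', z', t', h1, h2, h3⟩)
          · exact Or.inl (Or.inl h)
          · exact Or.inr ⟨y, z, t, Or.inl rfl, hz, h⟩
          · exact Or.inl (Or.inr h)
          · exact Or.inr ⟨y', z', t', Or.inr h1, h2, h3⟩
      have e2 : ncM [x] (y :: t) = Mono (z :: t) := by
        have := nearConcat_snoc_cons [] t x y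
        simp only [List.nil_append] at this
        simp only [ncM, this, hz]
        simp
      have hz' : z :: t ∉ stepS x A := by
        rintro (⟨d, hd, h⟩ | ⟨y', z', t', h1, h2, h3⟩)
        · simp at h; rw [← h.1] at hz; exact add?_ne hz
        · simp at h3; obtain ⟨rfl, rfl⟩ := h3
          exact hδ (add?_inj hz h2 ▸ h1)
      have hx' : x :: y :: t ∉ insert (z :: t) (stepS x A) := by
        rintro (h | h)
        · simp at h
        · exact hx h
      rw [e]
      refine ⟨(hf.insert _).insert _, ?_⟩
      have h1 : SM (insert (x :: y :: t) (insert (z :: t) (stepS x A)))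
          = Mono (x :: y :: t) + SM (insert (z :: t) (stepS x A)) :=
        finsum_mem_insert _ hx' (hf.insert _)
      have h2 : SM (insert (z :: t) (stepS x A)) = Mono (z :: t) + SM (stepS x A) :=
        finsum_mem_insert _ hz' hf
      rw [h1, h2, ih]
      simp only [map_add, cL_mono, oL_mono, e2, List.singleton_append]
      abel

theorem weakCover_cons {x : DEntry} {α β : DComp} (h : WeakCover α β) :
    WeakCover (x :: α) (x :: β) := by
  obtain ⟨l, r, a, b, c, rfl, h, rfl⟩ := h
  exact ⟨x :: l, r, a, b, c, rfl, h, rfl⟩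

theorem weakLe_cons {x : DEntry} {α β : DComp} (h : WeakLe α β) :
    WeakLe (x :: α) (x :: β) := by
  induction h with
  | refl => exact .refl
  | tail _ h ih => exact .tail ih (weakCover_cons h)

theorem weakLe_nil : {γ | WeakLe [] γ} = {[]} := by
  ext γ
  simp only [Set.mem_ofPred_eq, Set.mem_singleton_iff]
  constructor
  · intro h
    induction h with
    | refl => rfl
    | tail _ h ih =>
      subst ih
      obtain ⟨l, r, a, b, c, h, _⟩ := h
      simp at h
  · rintro rfl; exact Relation.ReflTransGen.refl

theorem weakLe_step (x : DEntry) (r : DComp) :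
    {γ | WeakLe (x :: r) γ} = stepS x {γ | WeakLe r γ} := by
  ext γ
  constructor
  · intro h
    simp only [Set.mem_ofPred_eq] at h
    induction h with
    | refl => exact Or.inl ⟨r, Relation.ReflTransGen.refl, rfl⟩
    | @tail β γ _ h ih =>
      obtain ⟨l, s, a, b, c, rfl, h, rfl⟩ := h
      rcases ih with ⟨δ, hδ, h1⟩ | ⟨y, z, t, h1, h2, h3⟩
      · cases l with
        | nil =>
          simp at h1
          obtain ⟨rfl, rfl⟩ := h1
          exact Or.inr ⟨b, c, s, hδ, h, rfl⟩
        | cons w l =>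
          simp at h1
          obtain ⟨rfl, rfl⟩ := h1
          exact Or.inl ⟨l ++ c :: s, Relation.ReflTransGen.tail hδ ⟨l, s, a, b, c, rfl, h, rfl⟩, rfl⟩
      · cases l with
        | nil =>
          simp at h3
          obtain ⟨rfl, rfl⟩ := h3
          have := add?_assoc x y b
          rw [h2] at this
          simp only [Option.bind_some, h] at this
          cases hv : add? y b with
          | none => rw [hv] at this; simp at this
          | some v =>
            rw [hv] at this
            exact Or.inr ⟨v, c, s, Relation.ReflTransGen.tail h1 ⟨[], s, y, b, v, rfl, hv, rfl⟩,
              this.symm, rfl⟩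
        | cons w l =>
          simp at h3
          obtain ⟨rfl, rfl⟩ := h3
          exact Or.inr ⟨y, w, l ++ c :: s,
            Relation.ReflTransGen.tail h1 ⟨y :: l, s, a, b, c, rfl, h, rfl⟩, h2, rfl⟩
  · rintro (⟨δ, hδ, rfl⟩ | ⟨y, z, t, h1, h2, rfl⟩)
    · exact weakLe_cons hδ
    · exact Relation.ReflTransGen.tail (weakLe_cons (x := x) h1) ⟨[], t, x, y, z, rfl, h2, rfl⟩

theorem weakLe_finite (r : DComp) : {γ | WeakLe r γ}.Finite := by
  induction r with
  | nil => rw [weakLe_nil]; simp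
  | cons x r ih => rw [weakLe_step]; exact (stepS_spec _ _ ih).1

@[simp] theorem T_nil : T [] = Mono [] := by
  rw [T, weakLe_nil]; simp

theorem T_cons (x : DEntry) (r : DComp) :
    T (x :: r) = cL (Mono [x]) (T r) + oL (Mono [x]) (T r) := by
  have := (stepS_spec x _ (weakLe_finite r)).2
  rw [← weakLe_step] at this
  exact this

theorem T_single (x : DEntry) : T [x] = Mono [x] := by
  rw [T_cons]; simp [ncM]

theorem T_NE (x : DEntry) (r : DComp) : T (x :: r) ∈ NE := by
  rw [T_cons]
  exact NE.add_mem (cL_NE_left _ (mono_NE _ _)) (oL_NE _ _)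

theorem T_append (a : DComp) (β : DComp) (h : a ≠ []) :
    T (a ++ β) = cL (T a) (T β) + oL (T a) (T β) := by
  induction a with
  | nil => exact absurd rfl h
  | cons x a ih =>
    cases a with
    | nil => rw [T_single]; exact T_cons x β
    | cons y a =>
      rw [List.cons_append, T_cons, ih (by simp), T_cons x (y :: a)]
      have := T_NE y a
      simp only [map_add, LinearMap.add_apply, cc, oo, co _ _ _ this, oc _ _ _ this]
      abel

theorem T_merge (a b : DComp) (x y z : DEntry) (h : add? x y = some z) :
    T (a ++ z :: b) = oL (T (a ++ [x])) (T (y :: b)) := by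
  induction a with
  | nil =>
    have h1 : oL (Mono [x]) (Mono [y]) = Mono [z] := by
      have := nearConcat_snoc_cons [] [] x y
      simp only [List.nil_append] at this
      rw [oL_mono]; simp [ncM, this, h]
    have := mono_NE y []
    simp only [List.nil_append, T_single]
    rw [T_cons, T_cons, map_add, ← oc _ _ _ this, ← oo, h1]
  | cons w a ih =>
    rw [List.cons_append, T_cons, ih, List.cons_append, T_cons w (a ++ [x])]
    have : T (a ++ [x]) ∈ NE := by
      cases a with
      | nil => exact T_NE _ _
      | cons u a => exact T_NE _ _
    simp only [map_add, LinearMap.add_apply, oo, co _ _ _ this]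

/-- Inductive refinement. -/
inductive Ref : DComp → DComp → Prop
  | nil : Ref [] []
  | cons (x : DEntry) {β α : DComp} : Ref β α → Ref (x :: β) (x :: α)
  | split (m n : ℕ+) {β α : DComp} : Ref β (undot n :: α) →
      Ref (undot m :: β) (undot (m + n) :: α)

theorem Ref.rfl' (α : DComp) : Ref α α := by
  induction α with
  | nil => exact .nil
  | cons x α ih => exact .cons x ih

theorem Ref.cover {β β' α : DComp} (h : StrongCover β β') (h' : Ref β' α) : Ref β α := by
  obtain ⟨l, r, a, b, rfl, rfl⟩ := h
  induction l generalizing α with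
  | nil =>
    simp only [List.nil_append] at h' ⊢
    cases h' with
    | cons x h => exact .split a b (.cons _ h)
    | split m n h => rw [add_assoc]; exact .split a _ (.split b n h)
  | cons x l ih =>
    simp only [List.cons_append] at h' ⊢
    cases h' with
    | cons x h => exact .cons _ (ih h)
    | split m n h => exact .split _ _ (ih h)

theorem strongLe_cons {x : DEntry} {α β : DComp} (h : StrongLe α β) :
    StrongLe (x :: α) (x :: β) := by
  induction h with
  | refl => exact .refl
  | tail _ h ih =>
    obtain ⟨l, r, a, b, rfl, rfl⟩ := h
    exact .tail ih ⟨x :: l, r, a, b, rfl, rfl⟩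

theorem strongLe_iff {β α : DComp} : StrongLe β α ↔ Ref β α := by
  constructor
  · intro h
    induction h using Relation.ReflTransGen.head_induction_on with
    | refl => exact Ref.rfl' _
    | head h _ ih => exact Ref.cover h ih
  · intro h
    induction h with
    | nil => exact .refl
    | cons x _ ih => exact strongLe_cons ih
    | split m n _ ih =>
      exact Relation.ReflTransGen.tail (strongLe_cons (x := undot m) ih) ⟨[], _, m, n, rfl, rfl⟩

def RS (α : DComp) : Set DComp := {β | Ref β α}

theorem Fund_eq (α : DComp) : Fund α = SM (RS α) := by
  simp only [Fund, SM, RS, strongLe_iff]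

theorem RS_nil : RS [] = {[]} := by
  ext β
  simp only [RS, Set.mem_ofPred_eq, Set.mem_singleton_iff]
  constructor
  · intro h; cases h; rfl
  · rintro rfl; exact .nil

theorem RS_dot (a : ℕ) (r : DComp) : RS (dot a :: r) = (fun δ => dot a :: δ) '' RS r := by
  ext β
  constructor
  · intro h; cases h with
    | cons x h => exact ⟨_, h, rfl⟩
  · rintro ⟨δ, h, rfl⟩; exact .cons _ h

theorem RS_one (r : DComp) : RS (undot 1 :: r) = (fun δ => undot 1 :: δ) '' RS r := by
  ext β
  constructor
  · intro h
    simp only [RS, Set.mem_ofPred_eq] at h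
    generalize hq : undot 1 :: r = q at h
    cases h with
    | nil => simp at hq
    | cons x h => simp at hq; obtain ⟨rfl, rfl⟩ := hq; exact ⟨_, h, rfl⟩
    | split m n h =>
      simp at hq
      have := congrArg PNat.val hq.1
      have h1 := m.pos
      have h2 := n.pos
      simp at this
      omega
  · rintro ⟨δ, h, rfl⟩; exact .cons _ h

theorem RS_succ (n : ℕ+) (r : DComp) :
    RS (undot (1 + n) :: r) = stepS (undot 1) (RS (undot n :: r)) := by
  ext β
  constructor
  · intro h
    simp only [RS, Set.mem_ofPred_eq] at h
    generalize hq : undot (1 + n) :: r = q at h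
    cases h with
    | nil => simp at hq
    | cons x h =>
      simp at hq; obtain ⟨rfl, rfl⟩ := hq
      exact Or.inr ⟨undot n, _, _, Ref.cons _ h, rfl, rfl⟩
    | split m k h =>
      simp at hq
      obtain ⟨hq, rfl⟩ := hq
      by_cases hm : m = 1
      · subst hm
        have : n = k := add_left_cancel hq
        subst this
        exact Or.inl ⟨_, h, rfl⟩
      · obtain ⟨m', rfl⟩ := PNat.exists_eq_succ_of_ne_one hm
        have : n = m' + k := by
          apply add_left_cancel (a := 1)
          rw [hq, ← add_assoc, add_comm 1 m']
        subst this
        exact Or.inr ⟨undot m', _, _, Ref.split m' k h, by simp [add?, add_comm], rfl⟩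
  · rintro (⟨δ, h, rfl⟩ | ⟨y, z, t, h1, h2, rfl⟩)
    · exact .split _ _ h
    · simp only [RS, Set.mem_ofPred_eq] at h1 ⊢
      cases h1 with
      | cons x h => simp [add?] at h2; subst h2; exact .cons _ h
      | split m k h =>
        simp [add?] at h2; subst h2
        rw [← add_assoc]
        exact .split _ _ h

theorem image_spec (x : DEntry) (A : Set DComp) (hA : A.Finite) :
    SM ((fun δ => x :: δ) '' A) = cL (Mono [x]) (SM A) := by
  have h1 : SM ((fun δ => x :: δ) '' A) = ∑ᶠ δ ∈ A, Mono (x :: δ) := by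
    rw [SM, finsum_mem_image]
    intro a _ b _ h
    simpa using h
  rw [h1, SM, finsum_mem_eq_finite_toFinset_sum _ hA, finsum_mem_eq_finite_toFinset_sum _ hA, map_sum]
  simp

theorem RS_finite (α : DComp) : (RS α).Finite := by
  induction α with
  | nil => rw [RS_nil]; simp
  | cons x r ih =>
    cases x with
    | dot a => rw [RS_dot]; exact ih.image _
    | undot n =>
      induction n using PNat.recOn with
      | one => rw [RS_one]; exact ih.image _
      | succ n ih' => rw [add_comm, RS_succ]; exact (stepS_spec _ _ ih').1

theorem Fund_nil : Fund [] = Mono [] := by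
  rw [Fund_eq, RS_nil]; simp [SM]

theorem Fund_dot (a : ℕ) (r : DComp) : Fund (dot a :: r) = cL (Mono [dot a]) (Fund r) := by
  rw [Fund_eq, Fund_eq, RS_dot, image_spec _ _ (RS_finite _)]

theorem Fund_one (r : DComp) : Fund (undot 1 :: r) = cL (Mono [undot 1]) (Fund r) := by
  rw [Fund_eq, Fund_eq, RS_one, image_spec _ _ (RS_finite _)]

theorem Fund_succ (n : ℕ+) (r : DComp) : Fund (undot (1 + n) :: r) =
    cL (Mono [undot 1]) (Fund (undot n :: r)) + oL (Mono [undot 1]) (Fund (undot n :: r)) := by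
  rw [Fund_eq, Fund_eq, RS_succ, (stepS_spec _ _ (RS_finite _)).2]

theorem Fund_NE (α : DComp) (h : α ≠ []) : Fund α ∈ NE := by
  cases α with
  | nil => exact absurd rfl h
  | cons x r =>
    cases x with
    | dot a => rw [Fund_dot]; exact cL_NE_left _ (mono_NE _ _)
    | undot n =>
      induction n using PNat.recOn with
      | one => rw [Fund_one]; exact cL_NE_left _ (mono_NE _ _)
      | succ n _ =>
        rw [add_comm, Fund_succ]
        exact NE.add_mem (cL_NE_left _ (mono_NE _ _)) (oL_NE _ _)

theorem Fund_merge (l r : DComp) (a b : ℕ+) :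
    Fund (l ++ undot (a + b) :: r) =
      cL (Fund (l ++ [undot a])) (Fund (undot b :: r)) +
      oL (Fund (l ++ [undot a])) (Fund (undot b :: r)) := by
  induction l with
  | nil =>
    simp only [List.nil_append]
    induction a using PNat.recOn with
    | one => rw [Fund_succ, Fund_one, Fund_nil]; simp
    | succ n ih =>
      have h := Fund_NE [undot n] (by simp)
      rw [add_comm n 1, add_assoc, Fund_succ, ih, Fund_succ]
      simp only [map_add, LinearMap.add_apply, cc, oo, co _ _ _ h, oc _ _ _ h]
      abel
  | cons x l ih =>
    have h := Fund_NE (l ++ [undot a]) (by simp)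
    simp only [List.cons_append]
    cases x with
    | dot c =>
      rw [Fund_dot, Fund_dot, ih]
      simp only [map_add, cc, co _ _ _ h]
    | undot n =>
      induction n using PNat.recOn with
      | one =>
        rw [Fund_one, Fund_one, ih]
        simp only [map_add, cc, co _ _ _ h]
      | succ n ih' =>
        have h := Fund_NE (undot n :: (l ++ [undot a])) (by simp)
        rw [add_comm n 1, Fund_succ, Fund_succ, ih']
        simp only [map_add, LinearMap.add_apply, cc, oo, co _ _ _ h, oc _ _ _ h]
        abel

@[simp] theorem fdeg_nil : fdeg [] = 0 := rfl
@[simp] theorem fdeg_dot (a : ℕ) (r : DComp) : fdeg (dot a :: r) = fdeg r + 1 := by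
  simp [fdeg, isDot]
@[simp] theorem fdeg_undot (a : ℕ+) (r : DComp) : fdeg (undot a :: r) = fdeg r := by
  simp [fdeg, isDot]
@[simp] theorem fdeg_append (l r : DComp) : fdeg (l ++ r) = fdeg l + fdeg r := by
  simp [fdeg]

theorem Ref.fdeg_eq {β α : DComp} (h : Ref β α) : fdeg β = fdeg α := by
  induction h with
  | nil => rfl
  | cons x _ ih => cases x <;> simp [ih]
  | split m n _ ih => simpa using ih

theorem Ref.head {β r : DComp} {b : ℕ+} (h : Ref β (undot b :: r)) :
    ∃ c s, β = undot c :: s := by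
  generalize hq : undot b :: r = q at h
  cases h with
  | nil => simp at hq
  | cons x h => simp at hq; exact ⟨b, _, by rw [hq.1]⟩
  | split m n h => exact ⟨_, _, rfl⟩

theorem Ref.last {β l : DComp} {a : ℕ+} (h : Ref β (l ++ [undot a])) :
    ∃ s c, β = s ++ [undot c] := by
  generalize hq : l ++ [undot a] = q at h
  induction h generalizing l a with
  | nil => simp at hq
  | @cons x β α h ih =>
    cases l with
    | nil =>
      simp at hq
      obtain ⟨rfl, rfl⟩ := hq
      cases h
      exact ⟨[], a, rfl⟩
    | cons y l =>
      simp at hq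
      obtain ⟨s, c, rfl⟩ := ih hq.2
      exact ⟨x :: s, c, rfl⟩
  | @split m n β α h ih =>
    have : ∃ l' a', l' ++ [undot a'] = undot n :: α := by
      cases l with
      | nil =>
        simp at hq
        exact ⟨[], n, by simp [← hq.2]⟩
      | cons y l =>
        simp at hq
        exact ⟨undot n :: l, a, by simp [hq.2]⟩
    obtain ⟨l', a', h'⟩ := this
    obtain ⟨s, c, rfl⟩ := ih h'
    exact ⟨undot m :: s, c, rfl⟩

theorem choose_two_add (p q : ℕ) : (p + q).choose 2 = p.choose 2 + q.choose 2 + p * q := by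
  induction p with
  | zero => simp
  | succ p ih =>
    rw [show p + 1 + q = (p + q) + 1 by ring, Nat.choose_succ_succ' (p + q) 1,
      Nat.choose_succ_succ' p 1, ih]
    simp
    ring

theorem S_basis (l r : DComp) (a b : ℕ+) :
    aL (cL (Mono (l ++ [undot a])) (Mono (undot b :: r))) +
      aL (oL (Mono (l ++ [undot a])) (Mono (undot b :: r))) =
    (-1 : ℚ) ^ (fdeg l * fdeg r) •
      cL (aL (Mono (undot b :: r))) (aL (Mono (l ++ [undot a]))) := by
  have h1 : oL (Mono (l ++ [undot a])) (Mono (undot b :: r)) = Mono (l ++ undot (a + b) :: r) := by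
    rw [oL_mono, ncM, nearConcat_snoc_cons]; simp [add?]
  rw [h1, cL_mono, aL_mono, aL_mono, aL_mono, aL_mono, List.reverse_append,
    T_append _ _ (by simp)]
  have h2 : T (l ++ undot (a + b) :: r).reverse =
      oL (T (undot b :: r).reverse) (T (l ++ [undot a]).reverse) := by
    have := T_merge r.reverse l.reverse (undot b) (undot a) (undot (a + b)) (by
      simp [add?, add_comm])
    simpa using this
  rw [h2]
  have h3 : sg (l ++ undot (a + b) :: r) = - sg (l ++ [undot a] ++ undot b :: r) := by
    simp [sg]; ring
  have h4 : sg (l ++ [undot a] ++ undot b :: r) =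
      (-1 : ℚ) ^ (fdeg l * fdeg r) * (sg (undot b :: r) * sg (l ++ [undot a])) := by
    simp only [sg, ← pow_add]
    congr 1
    simp [choose_two_add]
    ring
  rw [h3, h4]
  simp only [map_smul, LinearMap.smul_apply, smul_smul, smul_add, neg_smul]
  rw [mul_comm (sg (undot b :: r))]
  abel

theorem Fund_sum (α : DComp) : Fund α = ∑ β ∈ (RS_finite α).toFinset, Mono β := by
  rw [Fund_eq, SM, finsum_mem_eq_finite_toFinset_sum _ (RS_finite α)]

theorem S_merge (l r : DComp) (a b : ℕ+) :
    aL (Fund (l ++ undot (a + b) :: r)) =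
    (-1 : ℚ) ^ (fdeg l * fdeg r) •
      cL (aL (Fund (undot b :: r))) (aL (Fund (l ++ [undot a]))) := by
  rw [Fund_merge, map_add, Fund_sum (l ++ [undot a]), Fund_sum (undot b :: r)]
  simp only [map_sum, LinearMap.sum_apply, Finset.smul_sum]
  simp only [← Finset.sum_add_distrib]
  rw [Finset.sum_comm]
  refine Finset.sum_congr rfl fun β hβ => Finset.sum_congr rfl fun δ hδ => ?_
  have hβ : Ref β (l ++ [undot a]) := by simpa [RS] using hβ
  have hδ : Ref δ (undot b :: r) := by simpa [RS] using hδ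
  have e1 := hβ.fdeg_eq
  have e2 := hδ.fdeg_eq
  obtain ⟨s, c, rfl⟩ := hβ.last
  obtain ⟨d, t, rfl⟩ := hδ.head
  simp at e1 e2
  rw [S_basis, e1, e2]

def sgnE (as : List DComp) : ℕ :=
  ∑ i ∈ Finset.range as.length, ∑ j ∈ Finset.range as.length,
    if i < j then fdeg (as.getD i []) * fdeg (as.getD j []) else 0

theorem sum_map_fdeg (as : List DComp) :
    (as.map fdeg).sum = ∑ i ∈ Finset.range as.length, fdeg (as.getD i []) := by
  induction as using List.reverseRecOn with
  | nil => simp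
  | append_singleton as b ih =>
    rw [List.map_append, List.sum_append, ih, List.length_append, List.length_singleton,
      Finset.sum_range_succ]
    congr 1
    · refine Finset.sum_congr rfl fun i hi => ?_
      rw [List.getD_append _ _ _ _ (by simpa using hi)]
    · simp

theorem sgnE_append (as : List DComp) (b : DComp) :
    sgnE (as ++ [b]) = sgnE as + (as.map fdeg).sum * fdeg b := by
  rw [sum_map_fdeg, Finset.sum_mul]
  simp only [sgnE, List.length_append, List.length_singleton]
  rw [Finset.sum_range_succ]
  have h0 : (∑ j ∈ Finset.range (as.length + 1), if as.length < j then
      fdeg ((as ++ [b]).getD as.length []) * fdeg ((as ++ [b]).getD j []) else 0) = 0 := by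
    refine Finset.sum_eq_zero fun j hj => if_neg ?_
    simp at hj; omega
  rw [h0, add_zero, ← Finset.sum_add_distrib]
  refine Finset.sum_congr rfl fun i hi => ?_
  simp only [Finset.mem_range] at hi
  rw [Finset.sum_range_succ, if_pos hi, List.getD_append _ _ _ _ hi]
  congr 1
  · refine Finset.sum_congr rfl fun j hj => ?_
    rw [List.getD_append as _ _ j (by simpa using hj)]
  · simp

theorem main (as : List DComp) (γ : DComp)
    (hfirst : ∀ i, 0 < i → ∀ h : i < as.length,
      ∃ x : DEntry, (as.get ⟨i, h⟩).head? = some x ∧ x.isDot = false)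
    (hlast : ∀ i, ∀ h : i < as.length, i + 1 < as.length →
      ∃ x : DEntry, (as.get ⟨i, h⟩).getLast? = some x ∧ x.isDot = false)
    (hdec : nearConcatFold as = some γ) :
    aL (Fund γ) = ((-1 : ℚ) ^ sgnE as) •
        ((as.reverse.map fun a => antipode (Fund a)).foldr cdot (Mono [])) ∧
    fdeg γ = (as.map fdeg).sum ∧
    ∀ a ∈ as.getLast?, ∀ l c, a = l ++ [undot c] → ∃ l' c', γ = l' ++ [undot c'] := by
  induction as using List.reverseRecOn generalizing γ with
  | nil => simp [nearConcatFold] at hdec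
  | append_singleton as b ih =>
    rcases List.eq_nil_or_concat as with rfl | ⟨as', a', has⟩
    · simp [nearConcatFold] at hdec
      subst hdec
      refine ⟨?_, by simp, ?_⟩
      · simp [sgnE, cdot_eq, antipode_eq]
      · intro a ha l c hl
        simp at ha
        exact ⟨l, c, by rw [ha, hl]⟩
    · have hfold : nearConcatFold (as ++ [b]) =
          (nearConcatFold as).bind fun x => nearConcat x b := by
        cases as with
        | nil => simp at has
        | cons u as => simp [nearConcatFold]
      rw [hfold] at hdec
      cases hg : nearConcatFold as with
      | none => rw [hg] at hdec; simp at hdec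
      | some γ' =>
        rw [hg] at hdec
        simp only [Option.bind_some] at hdec
        obtain ⟨h1, h2, h3⟩ := ih γ'
          (fun i hi h => by
            have := hfirst i hi (by simp; omega)
            simpa [List.getElem_append_left h] using this)
          (fun i h h' => by
            have := hlast i (by simp; omega) (by simp; omega)
            simpa [List.getElem_append_left h] using this) hg
        have hpos : 0 < as.length := by rw [has]; simp
        obtain ⟨x, hx, hxd⟩ := hlast (as.length - 1) (by simp <;> omega) (by simp <;> omega)
        obtain ⟨y, hy, hyd⟩ := hfirst as.length hpos (by simp)
        have hx' : a'.getLast? = some x := by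
          subst has
          simpa [List.getElem_append_left] using hx
        have hy' : b.head? = some y := by simpa using hy
        obtain ⟨c, rfl⟩ : ∃ c, x = undot c := by
          cases x with
          | undot c => exact ⟨c, rfl⟩
          | dot c => simp [isDot] at hxd
        obtain ⟨d, rfl⟩ : ∃ c, y = undot c := by
          cases y with
          | undot c => exact ⟨c, rfl⟩
          | dot c => simp [isDot] at hyd
        obtain ⟨l0, hl0⟩ := List.getLast?_eq_some_iff.1 hx'
        obtain ⟨l, p, rfl⟩ := h3 a' (by rw [has]; simp) l0 c hl0
        obtain ⟨r, rfl⟩ : ∃ r, b = undot d :: r := by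
          cases b with
          | nil => simp at hy'
          | cons w r => simp at hy'; exact ⟨r, by rw [hy']⟩
        rw [nearConcat_snoc_cons] at hdec
        simp [add?] at hdec
        subst hdec
        refine ⟨?_, ?_, ?_⟩
        · rw [S_merge, h1, sgnE_append, ← h2]
          simp only [List.reverse_append, List.reverse_singleton, List.singleton_append,
            List.map_cons, List.foldr_cons, cdot_eq, antipode_eq, map_smul, smul_smul]
          congr 1
          simp [pow_add, mul_comm]
        · simp at h2 ⊢
          exact h2
        · intro a ha l1 c1 hl
          simp at ha
          subst ha
          cases l1 with
          | nil =>
            simp at hl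
            exact ⟨l, p + d, by rw [hl.2]⟩
          | cons w l1 =>
            simp at hl
            exact ⟨l ++ undot (p + d) :: l1, c1, by simp [hl.2]⟩

end DC

/-- If `γ = α⁽¹⁾ ⊙ ⋯ ⊙ α⁽ℓ⁾` is the column decomposition of `γ`
(each `α⁽ⁱ⁾` a column, the first entry of `α⁽ⁱ⁾` undotted for `i ≥ 2`, and the last
entry of `α⁽ⁱ⁾` undotted for `i ≤ ℓ−1`), then
`S(L_γ) = (−1)^{sign(γ)} S(L_{α⁽ˡ⁾}) • ⋯ • S(L_{α⁽¹⁾})`, where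
`sign(γ) = ∑_{i<j} m_{α⁽ⁱ⁾} m_{α⁽ʲ⁾}`. -/
theorem antipode_fund_column_decomposition (as : List DComp) (γ : DComp)
    (hne : as ≠ [])
    (hcol : ∀ a ∈ as, IsColumn a)
    (hfirst : ∀ i, 0 < i → ∀ h : i < as.length,
      ∃ x : DEntry, (as.get ⟨i, h⟩).head? = some x ∧ x.isDot = false)
    (hlast : ∀ i, ∀ h : i < as.length, i + 1 < as.length →
      ∃ x : DEntry, (as.get ⟨i, h⟩).getLast? = some x ∧ x.isDot = false)
    (hdec : nearConcatFold as = some γ) :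
    antipode (Fund γ) =
      ((-1 : ℚ) ^ (∑ i ∈ Finset.range as.length, ∑ j ∈ Finset.range as.length,
          if i < j then DComp.fdeg (as.getD i []) * DComp.fdeg (as.getD j []) else 0)) •
        ((as.reverse.map fun a => antipode (Fund a)).foldr cdot (Mono [])) := by
  rw [DC.antipode_eq]
  exact (DC.main as γ hfirst hlast hdec).1
end

section
/- Let α be a dotted composition that is a column. Then S(L_α) = (−1)^{ℓ(α)+binom(m_α,2)} Σ_β L_β, where the sum is over all maximal dotted compositions β such that β ⊵ Rev(α). -/
/-- A dotted composition is maximal if no two consecutive entries are both undotted. -/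
def IsMaximalD (β : DComp) : Prop :=
  β.Chain' (fun x y => x.isDot = true ∨ y.isDot = true)

namespace DComp

theorem isDot_undot (a : ℕ+) : (DEntry.undot a).isDot = false := rfl

theorem isDot_dot (a : ℕ) : (DEntry.dot a).isDot = true := rfl

theorem maximal_iff (β : DComp) : IsMaximalD β ↔
    β.IsChain (fun x y => x.isDot = true ∨ y.isDot = true) := Iff.rfl

theorem WeakCover.deg_eq {β α : DComp} (h : WeakCover β α) : deg β = deg α ∧ fdeg β = fdeg α := by
  obtain ⟨l, r, x, y, z, rfl, hz, rfl⟩ := h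
  cases x <;> cases y <;> simp [DEntry.add?] at hz <;> subst hz <;>
    simp [deg, fdeg, DEntry.val, DEntry.isDot, List.filter_append, List.filter_cons] <;> omega

theorem WeakLe.deg_eq {β α : DComp} (h : WeakLe β α) : deg β = deg α ∧ fdeg β = fdeg α := by
  induction h with
  | refl => exact ⟨rfl, rfl⟩
  | tail _ h ih => exact ⟨ih.1.trans h.deg_eq.1, ih.2.trans h.deg_eq.2⟩

theorem StrongCover.weak {β α : DComp} (h : StrongCover β α) : WeakCover β α := by
  obtain ⟨l, r, a, b, rfl, rfl⟩ := h
  exact ⟨l, r, _, _, _, rfl, rfl, rfl⟩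

theorem StrongLe.weak {β α : DComp} (h : StrongLe β α) : WeakLe β α :=
  Relation.ReflTransGen.mono (fun _ _ h => StrongCover.weak h) _ _ h

theorem length_le (α : DComp) : α.length ≤ deg α + fdeg α := by
  induction α with
  | nil => simp
  | cons e l ih =>
    cases e with
    | undot a =>
      have := a.pos
      simp [deg, fdeg, DEntry.val, DEntry.isDot] at ih ⊢; omega
    | dot a =>
      simp [deg, fdeg, DEntry.val, DEntry.isDot] at ih ⊢; omega

theorem val_le {α : DComp} {e : DEntry} (h : e ∈ α) : e.val ≤ deg α :=
  List.le_sum_of_mem (List.mem_map_of_mem h)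

theorem finite_entries (d : ℕ) : {e : DEntry | e.val ≤ d}.Finite := by
  refine (((Finset.range (d+1)).finite_toSet.image DEntry.dot).union
    ((Finset.range (d+1)).finite_toSet.image (fun n => DEntry.undot n.succPNat))).subset ?_
  rintro (a | a) h
  · right
    refine ⟨a.natPred, ?_, by simp⟩
    have := PNat.natPred_add_one a
    simp [DEntry.val] at h ⊢
    omega
  · left
    exact ⟨a, by simpa [DEntry.val, Nat.lt_succ_iff] using h, rfl⟩

theorem finite_lists (s : Set DEntry) (hs : s.Finite) (n : ℕ) :
    {l : DComp | l.length ≤ n ∧ ∀ e ∈ l, e ∈ s}.Finite := by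
  have : Finite s := hs
  refine ((List.finite_length_le s n).image (List.map Subtype.val)).subset ?_
  rintro l ⟨h1, h2⟩
  exact ⟨l.attach.map (fun x => ⟨x.1, h2 _ x.2⟩), by simpa using h1, by simp⟩

theorem finite_deg (d m : ℕ) : {α : DComp | deg α = d ∧ fdeg α = m}.Finite := by
  refine (finite_lists _ (finite_entries d) (d + m)).subset ?_
  rintro α ⟨rfl, rfl⟩
  exact ⟨length_le α, fun e he => val_le he⟩

theorem finite_up (α : DComp) : {γ | WeakLe α γ}.Finite :=
  (finite_deg (deg α) (fdeg α)).subset fun _ h => ⟨h.deg_eq.1.symm, h.deg_eq.2.symm⟩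

theorem finite_down (α : DComp) : {γ | StrongLe γ α}.Finite :=
  (finite_deg (deg α) (fdeg α)).subset fun _ h => h.weak.deg_eq

/-- Merging cons. -/
def mcons : DEntry → DComp → DComp
  | .undot a, .undot b :: r => .undot (a + b) :: r
  | x, l => x :: l

/-- The maximal composition above. -/
def mx (l : DComp) : DComp := l.foldr mcons []

theorem mcons_mcons (a b : ℕ+) (s : DComp) :
    mcons (.undot a) (mcons (.undot b) s) = mcons (.undot (a + b)) s := by
  rcases s with _ | ⟨⟨c⟩ | ⟨c⟩, s⟩ <;> simp [mcons, add_assoc]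

theorem mx_cover {β α : DComp} (h : StrongCover β α) : mx β = mx α := by
  obtain ⟨l, r, a, b, rfl, rfl⟩ := h
  simp [mx, List.foldr_append, mcons_mcons]

theorem mx_le {β α : DComp} (h : StrongLe β α) : mx β = mx α := by
  induction h with
  | refl => rfl
  | tail _ h ih => exact ih.trans (mx_cover h)

theorem maximal_mcons (x : DEntry) (l : DComp) (h : IsMaximalD l) : IsMaximalD (mcons x l) := by
  rw [maximal_iff] at *
  rcases x with a | a <;> rcases l with _ | ⟨⟨c⟩ | ⟨c⟩, _ | ⟨y, s⟩⟩ <;>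
    simp_all [mcons, isDot_undot, isDot_dot]

theorem maximal_mx (l : DComp) : IsMaximalD (mx l) := by
  induction l with
  | nil => simp [mx, maximal_iff]
  | cons x l ih => exact maximal_mcons x _ ih

theorem mx_of_maximal (l : DComp) (h : IsMaximalD l) : mx l = l := by
  induction l with
  | nil => rfl
  | cons x l ih =>
    have h2 : mx l = l := ih (List.IsChain.tail h)
    change mcons x (mx l) = _
    rw [h2]
    rcases x with a | a <;> rcases l with _ | ⟨⟨c⟩ | ⟨c⟩, s⟩ <;>
      simp_all [mcons, maximal_iff, isDot_undot, isDot_dot]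

theorem StrongLe.cons (x : DEntry) {l l' : DComp} (h : StrongLe l l') :
    StrongLe (x :: l) (x :: l') := by
  refine Relation.ReflTransGen.lift (fun l => x :: l) ?_ _ _ h
  rintro _ _ ⟨l, r, a, b, rfl, rfl⟩
  exact ⟨x :: l, r, a, b, rfl, rfl⟩

theorem le_mcons (x : DEntry) (l : DComp) : StrongLe (x :: l) (mcons x l) := by
  rcases x with a | a <;> rcases l with _ | ⟨⟨c⟩ | ⟨c⟩, s⟩ <;> simp only [mcons]
  all_goals first
    | exact Relation.ReflTransGen.refl
    | exact Relation.ReflTransGen.single ⟨[], s, a, c, rfl, rfl⟩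

theorem le_mx (l : DComp) : StrongLe l (mx l) := by
  induction l with
  | nil => exact Relation.ReflTransGen.refl
  | cons x l ih => exact (ih.cons x).trans (le_mcons x _)

theorem WeakLe.append {a b c d : DComp} (h : WeakLe a b) (h' : WeakLe c d) :
    WeakLe (a ++ c) (b ++ d) := by
  have h1 : WeakLe (a ++ c) (b ++ c) := by
    refine Relation.ReflTransGen.lift (fun l => l ++ c) ?_ _ _ h
    rintro _ _ ⟨l, r, x, y, z, rfl, hz, rfl⟩
    exact ⟨l, r ++ c, x, y, z, by simp, hz, by simp⟩
  have h2 : WeakLe (b ++ c) (b ++ d) := by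
    refine Relation.ReflTransGen.lift (fun l => b ++ l) ?_ _ _ h'
    rintro _ _ ⟨l, r, x, y, z, rfl, hz, rfl⟩
    exact ⟨b ++ l, r, x, y, z, by simp, hz, by simp⟩
  exact h1.trans h2

theorem WeakLe.split {A B : DComp} (h : WeakLe A B) : ∀ u v, B = u ++ v →
    ∃ A1 A2, A = A1 ++ A2 ∧ WeakLe A1 u ∧ WeakLe A2 v := by
  induction h with
  | refl => exact fun u v h => ⟨u, v, h, .refl, .refl⟩
  | tail _ h ih =>
    rintro u v huv
    obtain ⟨l, r, x, y, z, rfl, hz, rfl⟩ := h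
    rcases List.append_eq_append_iff.1 huv with ⟨t, rfl, ht⟩ | ⟨t, rfl, ht⟩
    · rcases t with _ | ⟨z', t⟩
      · obtain ⟨A1, A2, rfl, h1, h2⟩ := ih l (x :: y :: r) rfl
        simp at ht
        exact ⟨A1, A2, rfl, by simpa using h1, h2.tail ⟨[], r, x, y, z, rfl, hz, ht.symm⟩⟩
      · simp at ht
        obtain ⟨rfl, rfl⟩ := ht
        obtain ⟨A1, A2, rfl, h1, h2⟩ := ih (l ++ x :: y :: t) v (by simp)
        exact ⟨A1, A2, rfl, h1.tail ⟨l, t, x, y, z, rfl, hz, rfl⟩, h2⟩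
    · obtain ⟨A1, A2, rfl, h1, h2⟩ := ih u (t ++ x :: y :: r) (by simp)
      exact ⟨A1, A2, rfl, h1, h2.tail ⟨t, r, x, y, z, rfl, hz, ht⟩⟩

theorem column_replicate (A : DComp) (hA : IsColumn A) (h : fdeg A = 0) :
    A = List.replicate (deg A) (.undot 1) := by
  induction A with
  | nil => simp [deg]
  | cons e l ih =>
    have h1 := hA e (by simp)
    have hl : IsColumn l := fun e he => hA e (by simp [he])
    rcases h1 with h1 | rfl
    · simp [fdeg, h1] at h
    · have h2 : fdeg l = 0 := by simpa [fdeg, DEntry.isDot] using h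
      have h3 : deg (DEntry.undot 1 :: l) = deg l + 1 := by simp [deg, DEntry.val]; omega
      rw [h3, List.replicate_succ, ← ih hl h2]

theorem replicate_le (n : ℕ+) : WeakLe (List.replicate n (.undot 1)) [.undot n] := by
  induction n using PNat.recOn with
  | one => exact .refl
  | succ n ih =>
    have : WeakLe (List.replicate n (.undot 1) ++ [.undot 1]) ([.undot n] ++ [.undot 1]) :=
      ih.append .refl
    rw [PNat.add_coe, PNat.one_coe, List.replicate_succ']
    exact this.tail ⟨[], [], _, _, _, rfl, rfl, rfl⟩

theorem column_cover {A β γ : DComp} (hA : IsColumn A) (h : WeakLe A β) (h' : StrongCover γ β) :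
    WeakLe A γ := by
  obtain ⟨l, r, a, b, rfl, rfl⟩ := h'
  obtain ⟨A1, A', rfl, h1, h'⟩ := h.split l _ rfl
  obtain ⟨A2, A3, rfl, h2, h3⟩ := h'.split [.undot (a+b)] r rfl
  have hc : IsColumn A2 := fun e he => hA e (by simp [he])
  have e := column_replicate A2 hc (by rw [h2.deg_eq.2]; simp [fdeg, DEntry.isDot])
  have e2 : deg A2 = a + b := by rw [h2.deg_eq.1]; simp [deg, DEntry.val]
  rw [e2, List.replicate_add] at e
  have h4 : WeakLe A2 ([.undot a] ++ [.undot b]) := by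
    rw [e]; exact (replicate_le a).append (replicate_le b)
  exact h1.append (h4.append h3)

theorem column_le {A β γ : DComp} (hA : IsColumn A) (h' : StrongLe γ β) (h : WeakLe A β) :
    WeakLe A γ := by
  induction h' with
  | refl => exact h
  | tail _ h2 ih => exact ih (column_cover hA h h2)

theorem fund_column {α : DComp} (hα : IsColumn α) : Fund α = Mono α := by
  have : {β | StrongLe β α} = {α} := by
    ext β
    constructor
    · intro h
      rcases Relation.ReflTransGen.cases_tail h with h | ⟨c, _, l, r, a, b, rfl, rfl⟩
      · exact h.symm
      · have := hα (.undot (a+b)) (by simp)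
        simp [DEntry.isDot] at this
        have h2 := congrArg PNat.val this
        have := a.pos
        have := b.pos
        simp at h2
        omega
    · rintro rfl; exact Relation.ReflTransGen.refl
  rw [Fund, this, finsum_mem_singleton]

end DComp

/-- For a column `α`,
`S(L_α) = (−1)^{ℓ(α) + binom(m_α,2)} ∑_β L_β`, the sum being over all maximal
dotted compositions `β` with `β ⊵ Rev(α)`. -/
theorem antipode_fund_column (α : DComp) (hα : IsColumn α) :
    antipode (Fund α) =
      ((-1 : ℚ) ^ (α.length + Nat.choose (DComp.fdeg α) 2)) •
        ∑ᶠ β ∈ {β | IsMaximalD β ∧ DComp.WeakLe α.reverse β}, Fund β := by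
  classical
  have hR : IsColumn α.reverse := fun e he => hα e (by simpa using he)
  have hfin := DComp.finite_up α.reverse
  have hfin2 : {β | IsMaximalD β ∧ DComp.WeakLe α.reverse β}.Finite :=
    hfin.subset fun _ h => h.2
  rw [DComp.fund_column hα, antipode, Mono, Finsupp.sum_single_index (by simp), one_mul]
  congr 1
  rw [finsum_mem_eq_finite_toFinset_sum _ hfin, finsum_mem_eq_finite_toFinset_sum _ hfin2]
  rw [← Finset.sum_fiberwise_of_maps_to (g := DComp.mx) (t := hfin2.toFinset)]
  · refine Finset.sum_congr rfl fun β hβ => ?_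
    simp only [Set.Finite.mem_toFinset, Set.mem_setOf_eq] at hβ
    rw [Fund, finsum_mem_eq_finite_toFinset_sum _ (DComp.finite_down β)]
    refine Finset.sum_congr ?_ fun _ _ => rfl
    ext γ
    simp only [Finset.mem_filter, Set.Finite.mem_toFinset, Set.mem_setOf_eq]
    constructor
    · rintro ⟨_, rfl⟩; exact DComp.le_mx γ
    · intro h
      exact ⟨DComp.column_le hR h hβ.2, (DComp.mx_le h).trans (DComp.mx_of_maximal β hβ.1)⟩
  · intro γ hγ
    simp only [Set.Finite.mem_toFinset, Set.mem_setOf_eq] at hγ ⊢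
    exact ⟨DComp.maximal_mx γ, hγ.trans (DComp.le_mx γ).weak⟩
end

section
/- Let α ⊢ (n,m) be a dotted composition. Then, in the ring R, L_α = Σ (∏_{j∈F(α)} θ_{i_j} x_{i_j}^{−1}) x_{i_1}⋯x_{i_{n+m}}, where the sum is over all weakly increasing sequences i_1 ≤ i_2 ≤ … ≤ i_{n+m} of positive integers such that i_k < i_{k+1} whenever k ∈ D(α) and i_k = i_{k+1} whenever k ∈ E(α); here (∏_{j∈F(α)} θ_{i_j} x_{i_j}^{−1}) x_{i_1}⋯x_{i_{n+m}} denotes the monomial obtained from x_{i_1}⋯x_{i_{n+m}} by replacing the factor x_{i_j} by θ_{i_j} for each j ∈ F(α), the θ-factors written in increasing order of j. -/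
namespace DComp

/-- `α_i + η_i` for an entry: the value plus 1 if dotted. -/
def entryW (e : DEntry) : ℕ := e.val + (if e.isDot then 1 else 0)

/-- The partial sum `p_i = (α_1+η_1) + ⋯ + (α_i+η_i)` (sum of the first `i` entries). -/
def psum (α : DComp) (i : ℕ) : ℕ := ((α.take i).map entryW).sum

/-- `D(α) = {p_1, …, p_{l−1}}`. -/
def Dset (α : DComp) : Set ℕ := {d | ∃ i, 1 ≤ i ∧ i < α.length ∧ d = psum α i}

/-- `E(α) = { j : p_{i−1} < j < p_i  for some i with α_i dotted }` (0-based `k = i−1`). -/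
def Eset (α : DComp) : Set ℕ :=
  {j | ∃ k, k < α.length ∧ (α.getD k (DEntry.undot 1)).isDot = true ∧
        psum α k < j ∧ j < psum α (k + 1)}

/-- `F(α) = { p_i : α_i dotted }` (0-based `k = i−1`). -/
def Fset (α : DComp) : Set ℕ :=
  {d | ∃ k, k < α.length ∧ (α.getD k (DEntry.undot 1)).isDot = true ∧ d = psum α (k + 1)}

end DComp

/-! ## The superspace ring `R` of formal power series in `x₁, x₂, …` and
anticommuting `θ₁, θ₂, …`, modelled by coefficient functions.

A monomial is written in normal form `θ_{j_1} ⋯ θ_{j_r} x^e` with `j_1 < ⋯ < j_r`,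
and is recorded as the pair `(θ-index set, x-exponent)`; an element of `R` is the
function assigning to each normal-form monomial its coefficient. -/

/-- A normal-form monomial: the set of `θ`-indices together with the `x`-exponents. -/
abbrev SMonomial : Type := Finset ℕ × (ℕ →₀ ℕ)

/-- The superspace ring `R`, as coefficient functions on normal-form monomials. -/
abbrev SRing : Type := SMonomial → ℚ

/-- The number of inversions of a list of natural numbers. -/
def inversions : List ℕ → ℕ
  | [] => 0
  | a :: t => t.countP (fun b => decide (b < a)) + inversions t

/-- The element of `R` given by the monomial `θ_{j_1} ⋯ θ_{j_r} x^e`, where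
`(j_1, …, j_r)` is the given list of `θ`-indices in the order in which the
`θ`-factors are written: it is `0` if an index is repeated (`θ_i² = 0`), and
otherwise `(−1)^{inversions}` times the corresponding normal-form monomial
(reordering anticommuting factors produces a sign). -/
noncomputable def smono (θs : List ℕ) (e : ℕ →₀ ℕ) : SRing :=
  fun k => if θs.Nodup ∧ k = (θs.toFinset, e) then (-1 : ℚ) ^ inversions θs else 0

/-- A formal (possibly infinite) sum of elements of `R`, computed coefficientwise. -/
noncomputable def formalSum {ι : Type} (s : Set ι) (f : ι → SRing) : SRing :=
  fun k => ∑ᶠ i ∈ s, f i k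

/-- The set encoding sequences `(i_1, …, i_N)` of positive integers as functions
`ℕ → ℕ` supported on positions `1, …, N`. -/
def SeqSet (N : ℕ) : Set (ℕ → ℕ) :=
  {i | (∀ k, 1 ≤ k → k ≤ N → 1 ≤ i k) ∧ ∀ k, (k = 0 ∨ N < k) → i k = 0}

/-- The monomial quasisymmetric function in superspace
`M_α = ∑_{i_1 < ⋯ < i_l} θ_{i_1}^{η_1} ⋯ θ_{i_l}^{η_l} x_{i_1}^{α_1} ⋯ x_{i_l}^{α_l}`
as an element of `R`. -/
noncomputable def MonoR (α : DComp) : SRing :=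
  formalSum {i : ℕ → ℕ | i ∈ SeqSet α.length ∧
      ∀ k, 1 ≤ k → k + 1 ≤ α.length → i k < i (k + 1)}
    (fun i => smono
      (((List.range α.length).filter
          (fun k => (α.getD k (DEntry.undot 1)).isDot)).map (fun k => i (k + 1)))
      (∑ k ∈ Finset.range α.length,
        Finsupp.single (i (k + 1)) ((α.getD k (DEntry.undot 1)).val)))

/-- The fundamental quasisymmetric function in superspace `L_α = ∑_{β ⪯ α} M_β`
as an element of `R`. -/
noncomputable def FundR (α : DComp) : SRing :=
  fun key => ∑ᶠ β ∈ {β | DComp.StrongLe β α}, MonoR β key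

/-- `F(α)` as a list, in increasing order. -/
def Flist (α : DComp) : List ℕ :=
  ((List.range α.length).filter
      (fun k => (α.getD k (DEntry.undot 1)).isDot)).map (fun k => DComp.psum α (k + 1))

/-- The monomial `(∏_{j ∈ F(α)} θ_{i_j} x_{i_j}^{−1}) x_{i_1} ⋯ x_{i_N}`: the
monomial obtained from `x_{i_1} ⋯ x_{i_N}` by replacing the factor `x_{i_j}` by
`θ_{i_j}` for each `j ∈ F(α)`, the `θ`-factors written in increasing order of `j`. -/
noncomputable def fmonomial (α : DComp) (N : ℕ) (i : ℕ → ℕ) : SRing :=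
  smono ((Flist α).map i)
    (∑ k ∈ (Finset.Icc 1 N).filter (fun k => k ∉ Flist α), Finsupp.single (i k) 1)

open DComp

def RefBlk : DEntry → DComp → Prop
  | .dot a, β => β = [.dot a]
  | .undot a, β => (∀ e ∈ β, e.isDot = false) ∧ (β.map DEntry.val).sum = a

def RefL : DComp → DComp → Prop
  | [], β => β = []
  | e :: α, β => ∃ β1 β2, β = β1 ++ β2 ∧ RefBlk e β1 ∧ RefL α β2

lemma refBlk_self (e : DEntry) : RefBlk e [e] := by
  cases e <;> simp [RefBlk, DEntry.isDot, DEntry.val]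

lemma refL_self (α : DComp) : RefL α α := by
  induction α with
  | nil => rfl
  | cons e α ih => exact ⟨[e], α, rfl, refBlk_self e, ih⟩

lemma refL_cover (α l r : DComp) (a b : ℕ+)
    (h : RefL α (l ++ DEntry.undot (a + b) :: r)) :
    RefL α (l ++ DEntry.undot a :: DEntry.undot b :: r) := by
  induction α generalizing l r with
  | nil => simp [RefL] at h
  | cons e α ih =>
    obtain ⟨β1, β2, h1, h2, h3⟩ := h
    rcases List.append_eq_append_iff.1 h1 with ⟨t, ht, ht2⟩ | ⟨t, ht, ht2⟩
    · cases t with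
      | nil =>
        simp only [List.nil_append] at ht2
        refine ⟨β1, DEntry.undot a :: DEntry.undot b :: r, by simp [ht], h2, ?_⟩
        apply ih [] r
        rw [List.nil_append, ht2]; exact h3
      | cons x t =>
        simp only [List.cons_append, List.cons.injEq] at ht2
        obtain ⟨rfl, rfl⟩ := ht2
        refine ⟨l ++ DEntry.undot a :: DEntry.undot b :: t, β2, by simp, ?_, h3⟩
        subst ht
        cases e with
        | dot c =>
          simp only [RefBlk] at h2
          cases l <;> simp at h2
        | undot c =>
          obtain ⟨h4, h5⟩ := h2
          refine ⟨?_, ?_⟩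
          · intro e he
            simp only [List.mem_append, List.mem_cons] at he h4
            rcases he with he | rfl | rfl | he
            · exact h4 _ (Or.inl he)
            · rfl
            · rfl
            · exact h4 _ (Or.inr (Or.inr he))
          · rw [← h5]; simp [DEntry.val]; ring
    · subst ht ht2
      refine ⟨β1, _, by rw [List.append_assoc], h2, ?_⟩
      exact ih t r h3

lemma refL_of_strongLe {β α : DComp} (h : StrongLe β α) : RefL α β := by
  induction h using Relation.ReflTransGen.head_induction_on with
  | refl => exact refL_self α
  | head h' _ ih =>
    obtain ⟨l, r, a, b, rfl, rfl⟩ := h'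
    exact refL_cover _ _ _ _ _ ih

lemma strongLe_append {β α : DComp} (l r : DComp) (h : StrongLe β α) :
    StrongLe (l ++ β ++ r) (l ++ α ++ r) := by
  refine Relation.ReflTransGen.lift (fun x => l ++ x ++ r) ?_ _ _ h
  rintro x y ⟨l', r', a, b, rfl, rfl⟩
  exact ⟨l ++ l', r' ++ r, a, b, by simp, by simp⟩

lemma strongLe_undot (t : DComp) (ht : ∀ e ∈ t, e.isDot = false) (a b : ℕ+)
    (h : (a : ℕ) = b + (t.map DEntry.val).sum) :
    StrongLe (DEntry.undot b :: t) [DEntry.undot a] := by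
  induction t generalizing b with
  | nil =>
    have : a = b := by apply PNat.coe_injective; simpa using h
    subst this; exact Relation.ReflTransGen.refl
  | cons e t ih =>
    cases e with
    | dot c => have := ht (.dot c) (by simp); simp [DEntry.isDot] at this
    | undot c =>
      refine Relation.ReflTransGen.head ⟨[], t, b, c, rfl, rfl⟩ ?_
      apply ih
      · intro e he; exact ht e (by simp [he])
      · simp [DEntry.val] at h ⊢; omega

lemma strongLe_of_blk {e : DEntry} {β : DComp} (h : RefBlk e β) : StrongLe β [e] := by
  cases e with
  | dot a => simp only [RefBlk] at h; subst h; exact Relation.ReflTransGen.refl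
  | undot a =>
    obtain ⟨h1, h2⟩ := h
    cases β with
    | nil => have := a.pos; simp at h2; omega
    | cons x β =>
      cases x with
      | dot c => have := h1 (.dot c) (by simp); simp [DEntry.isDot] at this
      | undot c =>
        apply strongLe_undot
        · intro e he; exact h1 e (by simp [he])
        · simp [DEntry.val] at h2 ⊢; omega

lemma strongLe_of_refL {α β : DComp} (h : RefL α β) : StrongLe β α := by
  induction α generalizing β with
  | nil => simp only [RefL] at h; subst h; exact Relation.ReflTransGen.refl
  | cons e α ih =>
    obtain ⟨β1, β2, rfl, h2, h3⟩ := h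
    have h4 := strongLe_append [] β2 (strongLe_of_blk h2)
    have h5 := strongLe_append [e] [] (ih h3)
    simp at h4 h5
    exact Relation.ReflTransGen.trans h4 h5

lemma strongLe_iff {α β : DComp} : StrongLe β α ↔ RefL α β :=
  ⟨refL_of_strongLe, strongLe_of_refL⟩

/-- expansion of a list of (entry, index) pairs -/
def expandP (P : List (DEntry × ℕ)) : List ℕ :=
  P.flatMap (fun p => List.replicate (entryW p.1) p.2)

lemma entryW_pos (e : DEntry) : 0 < entryW e := by
  cases e with
  | dot a => simp [entryW, DEntry.isDot]
  | undot a => simp [entryW, DEntry.isDot, DEntry.val]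

lemma expandP_append (P Q) : expandP (P ++ Q) = expandP P ++ expandP Q := by
  simp [expandP]

lemma expandP_cons (p Q) :
    expandP (p :: Q) = List.replicate (entryW p.1) p.2 ++ expandP Q := by
  simp [expandP]

lemma mem_expandP (P) (c : ℕ) : c ∈ expandP P ↔ c ∈ P.map Prod.snd := by
  induction P with
  | nil => simp [expandP]
  | cons p P ih =>
    rw [expandP_cons, List.mem_append, ih]
    have := entryW_pos p.1
    simp only [List.mem_replicate, List.map_cons, List.mem_cons]
    constructor
    · rintro (h | h); exacts [Or.inl h.2, Or.inr h]
    · rintro (h | h); exacts [Or.inl ⟨by omega, h⟩, Or.inr h]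

lemma length_expandP (P) : (expandP P).length = ((P.map Prod.fst).map entryW).sum := by
  induction P with
  | nil => simp [expandP]
  | cons p P ih => simp [expandP_cons, ih]

lemma sum_entryW_blk {e : DEntry} {β : DComp} (h : RefBlk e β) :
    (β.map entryW).sum = entryW e := by
  cases e with
  | dot a => simp only [RefBlk] at h; subst h; simp
  | undot a =>
    obtain ⟨h1, h2⟩ := h
    have : β.map entryW = β.map DEntry.val := by
      apply List.map_congr_left
      intro e he
      simp [entryW, h1 e he]
    rw [this, h2]; simp [entryW, DEntry.isDot, DEntry.val]

lemma sum_entryW_refL {α β : DComp} (h : RefL α β) :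
    (β.map entryW).sum = (α.map entryW).sum := by
  induction α generalizing β with
  | nil => simp only [RefL] at h; subst h; rfl
  | cons e α ih =>
    obtain ⟨β1, β2, rfl, h2, h3⟩ := h
    simp [sum_entryW_blk h2, ih h3]

lemma expandP_sorted (P : List (DEntry × ℕ)) (h : (P.map Prod.snd).Pairwise (· < ·)) :
    (expandP P).Pairwise (· ≤ ·) := by
  induction P with
  | nil => simp [expandP]
  | cons p P ih =>
    rw [List.map_cons, List.pairwise_cons] at h
    rw [expandP_cons, List.pairwise_append]
    refine ⟨by simp [List.pairwise_replicate], ih h.2, ?_⟩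
    intro a ha b hb
    rw [mem_expandP] at hb
    rw [List.eq_of_mem_replicate ha]
    exact (h.1 b hb).le

def GoodW : DComp → List ℕ → Prop
  | [], w => w = []
  | e :: α, w => ∃ u v, w = u ++ v ∧ u.length = entryW e ∧
      (e.isDot = true → u.Pairwise (· = ·)) ∧ (∀ a ∈ u, ∀ b ∈ v, a < b) ∧ GoodW α v

lemma goodW_expandP (α : DComp) (P : List (DEntry × ℕ)) (h1 : RefL α (P.map Prod.fst))
    (h2 : (P.map Prod.snd).Pairwise (· < ·)) : GoodW α (expandP P) := by
  induction α generalizing P with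
  | nil => simp [RefL] at h1; subst h1; rfl
  | cons e α ih =>
    obtain ⟨β1, β2, h3, h4, h5⟩ := h1
    obtain ⟨P1, P2, rfl, rfl, rfl⟩ := List.map_eq_append_iff.1 h3
    rw [List.map_append, List.pairwise_append] at h2
    refine ⟨expandP P1, expandP P2, expandP_append _ _, ?_, ?_, ?_, ih P2 h5 h2.2.1⟩
    · rw [length_expandP, sum_entryW_blk h4]
    · intro hd
      cases e with
      | undot a => simp [DEntry.isDot] at hd
      | dot a =>
        simp only [RefBlk] at h4
        obtain ⟨p, rfl, hp⟩ := List.map_eq_singleton_iff.1 h4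
        simp [expandP, List.pairwise_replicate]
    · intro a ha b hb
      rw [mem_expandP] at ha hb
      exact h2.2.2 a ha b hb

lemma count_expandP_zero (P : List (DEntry × ℕ)) (c : ℕ) (h : ∀ b ∈ P.map Prod.snd, c < b) :
    (expandP P).count c = 0 := by
  rw [List.count_eq_zero, mem_expandP]
  intro hc; exact lt_irrefl _ (h c hc)

lemma expandP_inj_undot (P Q : List (DEntry × ℕ))
    (hP : ∀ p ∈ P, p.1.isDot = false) (hQ : ∀ p ∈ Q, p.1.isDot = false)
    (hP2 : (P.map Prod.snd).Pairwise (· < ·)) (hQ2 : (Q.map Prod.snd).Pairwise (· < ·))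
    (h : expandP P = expandP Q) : P = Q := by
  induction P generalizing Q with
  | nil =>
    cases Q with
    | nil => rfl
    | cons q Q =>
      have := entryW_pos q.1
      have h := congrArg List.length h
      simp [expandP_cons, expandP] at h; omega
  | cons p P ih =>
    cases Q with
    | nil =>
      have := entryW_pos p.1
      have h := congrArg List.length h
      simp [expandP_cons, expandP] at h; omega
    | cons q Q =>
      rw [List.map_cons, List.pairwise_cons] at hP2 hQ2
      rw [expandP_cons, expandP_cons] at h
      have hc : p.2 = q.2 := by
        have h1 := congrArg List.head? h
        have e1 := (entryW_pos p.1).ne'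
        have e2 := (entryW_pos q.1).ne'
        simpa [List.head?_append, List.head?_replicate, e1, e2] using h1
      have hw : entryW p.1 = entryW q.1 := by
        have h1 := congrArg (List.count p.2) h
        rw [List.count_append, List.count_append, count_expandP_zero P _ hP2.1] at h1
        rw [hc, count_expandP_zero Q _ hQ2.1] at h1
        simpa using h1
      have hpq : p = q := by
        have d1 := hP p (by simp)
        have d2 := hQ q (by simp)
        obtain ⟨e, c⟩ := p
        obtain ⟨e', c'⟩ := q
        cases e <;> cases e' <;> simp_all [DEntry.isDot, entryW, DEntry.val]
      subst hpq
      rw [ih Q (fun p hp => hP p (by simp [hp])) (fun p hp => hQ p (by simp [hp])) hP2.2 hQ2.2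
        (List.append_cancel_left h)]

lemma expandP_inj_blk (e : DEntry) (P Q : List (DEntry × ℕ))
    (hP : RefBlk e (P.map Prod.fst)) (hQ : RefBlk e (Q.map Prod.fst))
    (hP2 : (P.map Prod.snd).Pairwise (· < ·)) (hQ2 : (Q.map Prod.snd).Pairwise (· < ·))
    (h : expandP P = expandP Q) : P = Q := by
  cases e with
  | dot a =>
    simp only [RefBlk] at hP hQ
    obtain ⟨⟨p, c⟩, rfl, hp⟩ := List.map_eq_singleton_iff.1 hP
    obtain ⟨⟨q, d⟩, rfl, hq⟩ := List.map_eq_singleton_iff.1 hQ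
    simp only at hp hq
    subst hp hq
    have := entryW_pos (DEntry.dot a)
    simp [expandP] at h
    rcases h with h | h
    · omega
    · rw [h]
  | undot a =>
    apply expandP_inj_undot P Q _ _ hP2 hQ2 h
    · intro p hp; exact hP.1 _ (List.mem_map_of_mem hp)
    · intro p hp; exact hQ.1 _ (List.mem_map_of_mem hp)

lemma expandP_inj (α : DComp) (P Q : List (DEntry × ℕ))
    (hP : RefL α (P.map Prod.fst)) (hQ : RefL α (Q.map Prod.fst))
    (hP2 : (P.map Prod.snd).Pairwise (· < ·)) (hQ2 : (Q.map Prod.snd).Pairwise (· < ·))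
    (h : expandP P = expandP Q) : P = Q := by
  induction α generalizing P Q with
  | nil => simp [RefL] at hP hQ; rw [hP, hQ]
  | cons e α ih =>
    obtain ⟨β1, β2, h3, h4, h5⟩ := hP
    obtain ⟨P1, P2, rfl, rfl, rfl⟩ := List.map_eq_append_iff.1 h3
    obtain ⟨γ1, γ2, h6, h7, h8⟩ := hQ
    obtain ⟨Q1, Q2, rfl, rfl, rfl⟩ := List.map_eq_append_iff.1 h6
    rw [List.map_append, List.pairwise_append] at hP2 hQ2
    rw [expandP_append, expandP_append] at h
    obtain ⟨h9, h10⟩ := List.append_inj h (by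
      rw [length_expandP, length_expandP, sum_entryW_blk h4, sum_entryW_blk h7])
    rw [expandP_inj_blk e P1 Q1 h4 h7 hP2.1 hQ2.1 h9, ih P2 Q2 h5 h8 hP2.2.1 hQ2.2.1 h10]

lemma expandP_surj_undot (w : List ℕ) (hw : w.Pairwise (· ≤ ·)) :
    ∃ P : List (DEntry × ℕ), (∀ p ∈ P, p.1.isDot = false) ∧
      (P.map Prod.snd).Pairwise (· < ·) ∧ expandP P = w := by
  induction w with
  | nil => exact ⟨[], by simp, by simp, rfl⟩
  | cons c w ih =>
    rw [List.pairwise_cons] at hw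
    obtain ⟨P, h1, h2, rfl⟩ := ih hw.2
    by_cases hc : c ∈ P.map Prod.snd
    · cases P with
      | nil => simp at hc
      | cons p P =>
        obtain ⟨e, d⟩ := p
        have hd : d = c := by
          rw [List.map_cons, List.pairwise_cons] at h2
          have h3 := hw.1 d ((mem_expandP _ _).2 (by simp))
          rw [List.map_cons, List.mem_cons] at hc
          rcases hc with hc | hc
          · exact hc.symm
          · have := h2.1 c hc
            simp only at this; omega
        subst hd
        cases e with
        | dot a => have := h1 (.dot a, d) (by simp); simp [DEntry.isDot] at this
        | undot a =>
          refine ⟨(.undot (a + 1), d) :: P, ?_, ?_, ?_⟩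
          · intro p hp
            rw [List.mem_cons] at hp
            rcases hp with rfl | hp
            · rfl
            · exact h1 p (by simp [hp])
          · simpa using h2
          · simp [expandP_cons, entryW, DEntry.val, DEntry.isDot, List.replicate_succ]
    · refine ⟨(.undot 1, c) :: P, ?_, ?_, ?_⟩
      · intro p hp
        rw [List.mem_cons] at hp
        rcases hp with rfl | hp
        · rfl
        · exact h1 p hp
      · rw [List.map_cons, List.pairwise_cons]
        refine ⟨fun b hb => ?_, h2⟩
        refine lt_of_le_of_ne (hw.1 b ((mem_expandP _ _).2 hb)) ?_
        rintro rfl; exact hc hb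
      · simp [expandP_cons, entryW, DEntry.val, DEntry.isDot]

lemma expandP_surj_blk (e : DEntry) (u : List ℕ) (hl : u.length = entryW e)
    (hu : u.Pairwise (· ≤ ·)) (hd : e.isDot = true → u.Pairwise (· = ·)) :
    ∃ P : List (DEntry × ℕ), RefBlk e (P.map Prod.fst) ∧
      (P.map Prod.snd).Pairwise (· < ·) ∧ expandP P = u := by
  cases e with
  | dot a =>
    have hd := hd rfl
    cases u with
    | nil => have := entryW_pos (.dot a); simp at hl; omega
    | cons c u =>
      refine ⟨[(.dot a, c)], by simp [RefBlk], by simp, ?_⟩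
      rw [List.pairwise_cons] at hd
      simp only [expandP, List.flatMap_cons, List.flatMap_nil, List.append_nil]
      symm
      rw [List.eq_replicate_iff]
      refine ⟨hl, fun b hb => ?_⟩
      rw [List.mem_cons] at hb
      rcases hb with rfl | hb
      · rfl
      · exact (hd.1 b hb).symm
  | undot a =>
    obtain ⟨P, h1, h2, rfl⟩ := expandP_surj_undot u hu
    have h3 : ∀ e ∈ P.map Prod.fst, e.isDot = false := by
      intro e he
      obtain ⟨p, hp, rfl⟩ := List.mem_map.1 he
      exact h1 p hp
    refine ⟨P, ⟨h3, ?_⟩, h2, rfl⟩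
    rw [length_expandP] at hl
    have : (P.map Prod.fst).map entryW = (P.map Prod.fst).map DEntry.val := by
      apply List.map_congr_left
      intro e he
      simp [entryW, h3 e he]
    rw [← this, hl]; simp [entryW, DEntry.isDot, DEntry.val]

lemma expandP_surj (α : DComp) (w : List ℕ) (hw : w.Pairwise (· ≤ ·)) (hg : GoodW α w) :
    ∃ P : List (DEntry × ℕ), RefL α (P.map Prod.fst) ∧
      (P.map Prod.snd).Pairwise (· < ·) ∧ expandP P = w := by
  induction α generalizing w with
  | nil => simp only [GoodW] at hg; subst hg; exact ⟨[], rfl, by simp, rfl⟩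
  | cons e α ih =>
    obtain ⟨u, v, rfl, h1, h2, h3, h4⟩ := hg
    rw [List.pairwise_append] at hw
    obtain ⟨P1, a1, a2, rfl⟩ := expandP_surj_blk e u h1 hw.1 h2
    obtain ⟨P2, b1, b2, rfl⟩ := ih v hw.2.1 h4
    refine ⟨P1 ++ P2, ⟨_, _, by rw [List.map_append], a1, b1⟩, ?_, expandP_append _ _⟩
    rw [List.map_append, List.pairwise_append]
    refine ⟨a2, b2, fun a ha b hb => h3 a ((mem_expandP _ _).2 ha) b ((mem_expandP _ _).2 hb)⟩


def toSeq (l : List ℕ) : ℕ → ℕ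
  | 0 => 0
  | k + 1 => l.getD k 0

lemma toSeq_zero (l) : toSeq l 0 = 0 := rfl
lemma toSeq_succ (l : List ℕ) (k : ℕ) : toSeq l (k + 1) = l.getD k 0 := rfl

lemma toSeq_append_left (u v : List ℕ) (k : ℕ) (h : k ≤ u.length) :
    toSeq (u ++ v) k = toSeq u k := by
  cases k with
  | zero => rfl
  | succ k => rw [toSeq_succ, toSeq_succ, List.getD_append _ _ _ _ (by omega)]

lemma toSeq_append_right (u v : List ℕ) (k : ℕ) (h : 1 ≤ k) :
    toSeq (u ++ v) (u.length + k) = toSeq v k := by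
  cases k with
  | zero => omega
  | succ k =>
    rw [← add_assoc, toSeq_succ, toSeq_succ, List.getD_append_right _ _ _ _ (by omega)]
    congr 1; omega

lemma toSeq_mem (l : List ℕ) (k : ℕ) (h1 : 1 ≤ k) (h2 : k ≤ l.length) : toSeq l k ∈ l := by
  cases k with
  | zero => omega
  | succ k =>
    rw [toSeq_succ, List.getD_eq_getElem _ _ (by omega)]
    exact List.getElem_mem _

lemma mem_toSeq (l : List ℕ) (c : ℕ) (h : c ∈ l) : ∃ k, 1 ≤ k ∧ k ≤ l.length ∧ toSeq l k = c := by
  obtain ⟨k, hk, rfl⟩ := List.getElem_of_mem h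
  exact ⟨k + 1, by omega, by omega, by rw [toSeq_succ, List.getD_eq_getElem _ _ hk]⟩

lemma toSeq_mem_SeqSet (l : List ℕ) (N : ℕ) (hl : l.length = N) (hp : ∀ c ∈ l, 1 ≤ c) :
    toSeq l ∈ SeqSet N := by
  subst hl
  refine ⟨fun k h1 h2 => hp _ (toSeq_mem l k h1 h2), ?_⟩
  rintro k (rfl | hk)
  · rfl
  · cases k with
    | zero => rfl
    | succ k => rw [toSeq_succ, List.getD_eq_default _ _ (by omega)]

lemma exists_toSeq (N : ℕ) (i : ℕ → ℕ) (hi : i ∈ SeqSet N) :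
    ∃ l : List ℕ, l.length = N ∧ (∀ c ∈ l, 1 ≤ c) ∧ toSeq l = i := by
  refine ⟨(List.range N).map (fun k => i (k + 1)), by simp, ?_, ?_⟩
  · intro c hc
    simp only [List.mem_map, List.mem_range] at hc
    obtain ⟨k, hk, rfl⟩ := hc
    exact hi.1 _ (by omega) (by omega)
  · funext k
    cases k with
    | zero => exact (hi.2 0 (Or.inl rfl)).symm
    | succ k =>
      rw [toSeq_succ]
      by_cases hk : k < N
      · rw [List.getD_eq_getElem _ _ (by simpa using hk)]; simp
      · rw [List.getD_eq_default _ _ (by simp; omega)]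
        exact (hi.2 _ (Or.inr (by omega))).symm

lemma toSeq_inj (l l' : List ℕ) (hl : l.length = l'.length) (h : toSeq l = toSeq l') : l = l' := by
  apply List.ext_getElem hl
  intro k h1 h2
  have := congrFun h (k + 1)
  rwa [toSeq_succ, toSeq_succ, List.getD_eq_getElem _ _ h1, List.getD_eq_getElem _ _ h2] at this

lemma toSeq_chain (r : ℕ → ℕ → Prop) [IsTrans ℕ r] (l : List ℕ) :
    (∀ k, 1 ≤ k → k + 1 ≤ l.length → r (toSeq l k) (toSeq l (k + 1))) ↔ l.Pairwise r := by
  rw [← List.isChain_iff_pairwise]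
  induction l with
  | nil => simp
  | cons a l ih =>
    cases l with
    | nil => simp; intro k h1 h2; omega
    | cons b l =>
      rw [List.isChain_cons_cons, ← ih]
      constructor
      · intro h
        refine ⟨by simpa [toSeq] using h 1 (by omega) (by simp), ?_⟩
        intro k h1 h2
        have := h (k + 1) (by omega) (by simpa using h2)
        obtain ⟨k, rfl⟩ : ∃ j, k = j + 1 := ⟨k - 1, by omega⟩
        simpa [toSeq] using this
      · rintro ⟨h1, h2⟩ k hk hk2
        obtain ⟨k, rfl⟩ : ∃ j, k = j + 1 := ⟨k - 1, by omega⟩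
        cases k with
        | zero => simpa [toSeq] using h1
        | succ k =>
          have := h2 (k + 1) (by omega) (by simpa using hk2)
          simpa [toSeq] using this

lemma psum_zero (α : DComp) : psum α 0 = 0 := by simp [psum]

lemma psum_cons_succ (e : DEntry) (α : DComp) (k : ℕ) :
    psum (e :: α) (k + 1) = entryW e + psum α k := by simp [psum]

lemma psum_succ_pos (α : DComp) (k : ℕ) (hk : k < α.length) : 0 < psum α (k + 1) := by
  cases α with
  | nil => simp at hk
  | cons e α => rw [psum_cons_succ]; have := entryW_pos e; omega

lemma psum_le (α : DComp) (k : ℕ) : psum α k ≤ (α.map entryW).sum := by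
  induction α generalizing k with
  | nil => simp [psum]
  | cons e α ih =>
    cases k with
    | zero => simp [psum]
    | succ k => rw [psum_cons_succ]; simpa using ih k

lemma mem_Dset_cons (e : DEntry) (α : DComp) (d : ℕ) :
    d ∈ Dset (e :: α) ↔ (α ≠ [] ∧ d = entryW e) ∨ ∃ d' ∈ Dset α, d = entryW e + d' := by
  constructor
  · rintro ⟨i, h1, h2, rfl⟩
    obtain ⟨i, rfl⟩ : ∃ j, i = j + 1 := ⟨i - 1, by omega⟩
    rw [psum_cons_succ]
    simp only [List.length_cons] at h2
    cases i with
    | zero =>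
      left
      refine ⟨?_, by simp [psum_zero]⟩
      rintro rfl; simp at h2
    | succ i => right; exact ⟨_, ⟨i + 1, by omega, by omega, rfl⟩, rfl⟩
  · rintro (⟨h, rfl⟩ | ⟨_, ⟨i, h1, h2, rfl⟩, rfl⟩)
    · refine ⟨1, le_rfl, ?_, ?_⟩
      · have := List.length_pos_iff.2 h; simpa using this
      · simp [psum]
    · exact ⟨i + 1, by omega, by simpa using h2, by rw [psum_cons_succ]⟩

lemma mem_Eset_cons (e : DEntry) (α : DComp) (d : ℕ) :
    d ∈ Eset (e :: α) ↔ (e.isDot = true ∧ 0 < d ∧ d < entryW e) ∨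
      ∃ d' ∈ Eset α, d = entryW e + d' := by
  constructor
  · rintro ⟨k, h1, h2, h3, h4⟩
    cases k with
    | zero =>
      left
      rw [psum_zero] at h3
      rw [psum_cons_succ, psum_zero] at h4
      exact ⟨by simpa using h2, h3, by simpa using h4⟩
    | succ k =>
      right
      rw [psum_cons_succ] at h3 h4
      refine ⟨d - entryW e, ⟨k, by simpa using h1, by simpa using h2, by omega, by omega⟩, by omega⟩
  · rintro (⟨h, h1, h2⟩ | ⟨d, ⟨k, h1, h2, h3, h4⟩, rfl⟩)
    · refine ⟨0, by simp, by simpa using h, by simpa [psum_zero] using h1, ?_⟩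
      rw [psum_cons_succ, psum_zero]; simpa using h2
    · refine ⟨k + 1, by simpa using h1, by simpa using h2, ?_, ?_⟩ <;> rw [psum_cons_succ] <;> omega

lemma Dset_pos (α : DComp) (d : ℕ) (h : d ∈ Dset α) : 1 ≤ d := by
  obtain ⟨i, h1, h2, rfl⟩ := h
  obtain ⟨i, rfl⟩ : ∃ j, i = j + 1 := ⟨i - 1, by omega⟩
  exact psum_succ_pos α i (by omega)

lemma goodW_iff (α : DComp) (w : List ℕ) (hl : w.length = (α.map entryW).sum)
    (hw : w.Pairwise (· ≤ ·)) :
    GoodW α w ↔ (∀ k ∈ Dset α, toSeq w k < toSeq w (k + 1)) ∧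
      (∀ k ∈ Eset α, toSeq w k = toSeq w (k + 1)) := by
  induction α generalizing w with
  | nil =>
    simp at hl; subst hl
    simp [GoodW, toSeq, Dset, Eset]
  | cons e α ih =>
    obtain ⟨u, v, rfl, hu⟩ : ∃ u v, w = u ++ v ∧ u.length = entryW e :=
      ⟨w.take (entryW e), w.drop (entryW e), by simp, by simp [hl]⟩
    have hv : v.length = (α.map entryW).sum := by simp [hu] at hl; exact hl
    have hep := entryW_pos e
    have hw2 := hw
    rw [List.pairwise_append] at hw
    have key1 : (e.isDot = true → u.Pairwise (· = ·)) ↔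
        ∀ k, (e.isDot = true ∧ 0 < k ∧ k < entryW e) →
          toSeq (u ++ v) k = toSeq (u ++ v) (k + 1) := by
      rw [← toSeq_chain (· = ·) u]
      constructor
      · rintro h k ⟨h1, h2, h3⟩
        rw [toSeq_append_left _ _ _ (by omega), toSeq_append_left _ _ _ (by omega)]
        exact h h1 k (by omega) (by omega)
      · intro h h1 k h2 h3
        have := h k ⟨h1, by omega, by omega⟩
        rwa [toSeq_append_left _ _ _ (by omega), toSeq_append_left _ _ _ (by omega)] at this
    have key2 : (∀ a ∈ u, ∀ b ∈ v, a < b) ↔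
        (α ≠ [] → toSeq (u ++ v) (entryW e) < toSeq (u ++ v) (entryW e + 1)) := by
      rw [toSeq_append_left _ _ _ hu.ge, ← hu, toSeq_append_right _ _ _ le_rfl]
      constructor
      · intro h hα
        apply h _ (toSeq_mem _ _ (by omega) le_rfl) _ (toSeq_mem _ _ le_rfl _)
        rw [hv]
        cases α with
        | nil => simp at hα
        | cons e' α => have := entryW_pos e'; simp; omega
      · intro h a ha b hb
        have hα : α ≠ [] := by
          rintro rfl
          simp at hv; simp [hv] at hb
        have h1 : a ≤ toSeq u u.length := by
          obtain ⟨k, hk1, hk2, rfl⟩ := mem_toSeq u a ha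
          rcases hk2.eq_or_lt with h | h
          · rw [h]
          · obtain ⟨k, rfl⟩ : ∃ j, k = j + 1 := ⟨k - 1, by omega⟩
            obtain ⟨n, hn⟩ : ∃ j, u.length = j + 1 := ⟨u.length - 1, by omega⟩
            rw [hn, toSeq_succ, toSeq_succ, List.getD_eq_getElem _ _ (by omega),
              List.getD_eq_getElem _ _ (by omega)]
            exact List.pairwise_iff_getElem.1 hw.1 _ _ _ _ (by omega)
        have h2 : toSeq v 1 ≤ b := by
          cases v with
          | nil => simp at hb
          | cons c v =>
            simp only [toSeq, List.getD_cons_zero]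
            rw [List.mem_cons] at hb
            rcases hb with rfl | hb
            · exact le_rfl
            · exact (List.pairwise_cons.1 hw.2.1).1 b hb
        exact lt_of_le_of_lt h1 (lt_of_lt_of_le (h hα) h2)
    have hg : GoodW (e :: α) (u ++ v) ↔ (e.isDot = true → u.Pairwise (· = ·)) ∧
        (∀ a ∈ u, ∀ b ∈ v, a < b) ∧ GoodW α v := by
      constructor
      · rintro ⟨u', v', h1, h2, h3⟩
        obtain ⟨rfl, rfl⟩ := List.append_inj h1 (by omega)
        exact h3
      · intro h; exact ⟨u, v, rfl, hu, h⟩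
    rw [hg, key1, key2, ih v hv hw.2.1]
    constructor
    · rintro ⟨h1, h2, h3, h4⟩
      constructor
      · intro k hk
        rw [mem_Dset_cons] at hk
        rcases hk with ⟨h, rfl⟩ | ⟨d, hd, rfl⟩
        · exact h2 h
        · rw [← hu, toSeq_append_right _ _ _ (Dset_pos α d hd), add_assoc,
            toSeq_append_right _ _ _ (by omega)]
          exact h3 d hd
      · intro k hk
        rw [mem_Eset_cons] at hk
        rcases hk with h | ⟨d, hd, rfl⟩
        · exact h1 k h
        · have : 1 ≤ d := by obtain ⟨k, _, _, h, _⟩ := hd; omega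
          rw [← hu, toSeq_append_right _ _ _ this, add_assoc,
            toSeq_append_right _ _ _ (by omega)]
          exact h4 d hd
    · rintro ⟨h1, h2⟩
      refine ⟨fun k hk => h2 k ((mem_Eset_cons _ _ _).2 (Or.inl hk)),
        fun hα => h1 _ ((mem_Dset_cons _ _ _).2 (Or.inl ⟨hα, rfl⟩)), fun d hd => ?_, fun d hd => ?_⟩
      · have := h1 _ ((mem_Dset_cons e α _).2 (Or.inr ⟨d, hd, rfl⟩))
        rwa [← hu, toSeq_append_right _ _ _ (Dset_pos α d hd), add_assoc,
            toSeq_append_right _ _ _ (by omega)] at this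
      · have h3 : 1 ≤ d := by obtain ⟨k, _, _, h, _⟩ := hd; omega
        have := h2 _ ((mem_Eset_cons e α _).2 (Or.inr ⟨d, hd, rfl⟩))
        rwa [← hu, toSeq_append_right _ _ _ h3, add_assoc,
            toSeq_append_right _ _ _ (by omega)] at this

lemma total_eq (α : DComp) : (α.map entryW).sum = deg α + fdeg α := by
  induction α with
  | nil => rfl
  | cons e α ih =>
    simp only [List.map_cons, List.sum_cons, ih, deg, fdeg, entryW, List.filter_cons]
    split <;> simp <;> ring

/-- Monomial data of a pair list. -/
def thP (P : List (DEntry × ℕ)) : List ℕ := (P.filter (fun p => p.1.isDot)).map Prod.snd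

noncomputable def exP (P : List (DEntry × ℕ)) : ℕ →₀ ℕ :=
  (P.map (fun p => Finsupp.single p.2 p.1.val)).sum

lemma mono_th (P : List (DEntry × ℕ)) :
    ((List.range (P.map Prod.fst).length).filter
          (fun k => ((P.map Prod.fst).getD k (DEntry.undot 1)).isDot)).map
            (fun k => toSeq (P.map Prod.snd) (k + 1)) = thP P := by
  induction P with
  | nil => simp [thP]
  | cons p P ih =>
    rw [List.map_cons, List.map_cons, List.length_cons, List.range_succ_eq_map]
    simp only [List.filter_cons, List.filter_map, List.map_map, Function.comp_def, thP,
      List.map_cons, List.getD_cons_zero, List.getD_cons_succ, toSeq_succ] at ih ⊢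
    split
    · simp only [List.map_cons, List.getD_cons_zero, List.map_map, Function.comp_def,
        Nat.succ_eq_add_one, List.getD_cons_succ, ih]
    · simp only [List.map_map, Function.comp_def,
        Nat.succ_eq_add_one, List.getD_cons_succ, ih]

lemma mono_ex (P : List (DEntry × ℕ)) :
    (∑ k ∈ Finset.range (P.map Prod.fst).length,
        Finsupp.single (toSeq (P.map Prod.snd) (k + 1))
          (((P.map Prod.fst).getD k (DEntry.undot 1)).val)) = exP P := by
  induction P with
  | nil => simp [exP]
  | cons p P ih =>
    rw [List.map_cons, List.length_cons, Finset.sum_range_succ']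
    simp only [toSeq_succ, List.map_cons, List.getD_cons_zero, List.getD_cons_succ, exP,
      List.sum_cons] at ih ⊢
    rw [ih, add_comm]

lemma Flist_cons (e : DEntry) (α : DComp) :
    Flist (e :: α) = (if e.isDot then [entryW e] else []) ++ (Flist α).map (entryW e + ·) := by
  simp only [Flist]
  rw [List.length_cons, List.range_succ_eq_map]
  simp only [List.filter_cons, List.filter_map, Function.comp_def,
      List.getD_cons_zero]
  split <;> simp [psum_cons_succ, psum_zero, Function.comp_def]

lemma Flist_pos (α : DComp) (k : ℕ) (h : k ∈ Flist α) : 1 ≤ k := by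
  simp only [Flist, List.mem_map, List.mem_filter, List.mem_range] at h
  obtain ⟨j, ⟨h1, _⟩, rfl⟩ := h
  exact psum_succ_pos α j h1

lemma thP_append (P Q) : thP (P ++ Q) = thP P ++ thP Q := by simp [thP]
lemma exP_append (P Q) : exP (P ++ Q) = exP P + exP Q := by simp [exP]

lemma fmon_th (α : DComp) (P : List (DEntry × ℕ)) (h : RefL α (P.map Prod.fst)) :
    (Flist α).map (toSeq (expandP P)) = thP P := by
  induction α generalizing P with
  | nil => simp [RefL] at h; subst h; simp [Flist, thP]
  | cons e α ih =>
    obtain ⟨β1, β2, h3, h4, h5⟩ := h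
    obtain ⟨P1, P2, rfl, rfl, rfl⟩ := List.map_eq_append_iff.1 h3
    have hl : (expandP P1).length = entryW e := by rw [length_expandP, sum_entryW_blk h4]
    rw [Flist_cons, expandP_append, thP_append, List.map_append, ← ih P2 h5, List.map_map]
    congr 1
    · cases e with
      | dot a =>
        simp only [RefBlk] at h4
        obtain ⟨⟨p, c⟩, rfl, hp⟩ := List.map_eq_singleton_iff.1 h4
        simp only at hp; subst hp
        simp only [DEntry.isDot, if_true, List.map_cons, List.map_nil]
        rw [toSeq_append_left _ _ _ hl.ge]
        have := toSeq_mem (expandP [(DEntry.dot a, c)]) (entryW (.dot a)) (entryW_pos _) hl.ge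
        rw [mem_expandP] at this
        simp at this
        rw [this]; simp [thP, DEntry.isDot]
      | undot a =>
        have : P1.filter (fun p => p.1.isDot) = [] := by
          rw [List.filter_eq_nil_iff]
          intro p hp
          simp [h4.1 _ (List.mem_map_of_mem hp)]
        rw [thP, this]; simp [DEntry.isDot]
    · apply List.map_congr_left
      intro k hk
      simp only [Function.comp]
      rw [← hl, toSeq_append_right _ _ _ (Flist_pos _ _ hk)]

lemma sum_toSeq (u : List ℕ) : ∑ k ∈ Finset.range u.length, Finsupp.single (toSeq u (k + 1)) 1 =
    (u.map (fun c => (Finsupp.single c 1 : ℕ →₀ ℕ))).sum := by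
  induction u with
  | nil => simp
  | cons c u ih =>
    rw [List.length_cons, Finset.sum_range_succ']
    simp only [toSeq_succ, List.map_cons, List.getD_cons_zero, List.getD_cons_succ,
      List.sum_cons] at ih ⊢
    rw [ih, add_comm]

lemma sum_expand_undot (P : List (DEntry × ℕ)) (h : ∀ p ∈ P, p.1.isDot = false) :
    ((expandP P).map (fun c => (Finsupp.single c 1 : ℕ →₀ ℕ))).sum = exP P := by
  induction P with
  | nil => simp [expandP, exP]
  | cons p P ih =>
    rw [expandP_cons, List.map_append, List.sum_append, ih (fun p hp => h p (by simp [hp]))]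
    have h1 := h p (by simp)
    simp [exP, entryW, h1]

lemma fmon_ex' (α : DComp) (P : List (DEntry × ℕ)) (h : RefL α (P.map Prod.fst)) :
    (∑ k ∈ Finset.range (α.map entryW).sum, if k + 1 ∈ Flist α then 0 else
      Finsupp.single (toSeq (expandP P) (k + 1)) 1) = exP P := by
  induction α generalizing P with
  | nil => simp [RefL] at h; subst h; simp [exP]
  | cons e α ih =>
    obtain ⟨β1, β2, h3, h4, h5⟩ := h
    obtain ⟨P1, P2, rfl, rfl, rfl⟩ := List.map_eq_append_iff.1 h3
    have hl : (expandP P1).length = entryW e := by rw [length_expandP, sum_entryW_blk h4]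
    rw [List.map_cons, List.sum_cons, Finset.sum_range_add, exP_append, ← ih P2 h5, expandP_append]
    congr 1
    · have hF : ∀ k ∈ Finset.range (entryW e), (k + 1 ∈ Flist (e :: α) ↔
          (e.isDot = true ∧ k + 1 = entryW e)) := by
        intro k hk
        rw [Finset.mem_range] at hk
        rw [Flist_cons, List.mem_append]
        constructor
        · rintro (h | h)
          · split at h
            · simp at h; exact ⟨by assumption, h⟩
            · simp at h
          · obtain ⟨j, hj, h⟩ := List.mem_map.1 h
            have := Flist_pos _ _ hj
            omega
        · rintro ⟨h1, h2⟩
          left; simp [h1, h2]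
      cases e with
      | dot a =>
        simp only [RefBlk] at h4
        obtain ⟨⟨p, c⟩, rfl, hp⟩ := List.map_eq_singleton_iff.1 h4
        simp only at hp; subst hp
        have hW : entryW (.dot a) = a + 1 := by simp [entryW, DEntry.isDot, DEntry.val]
        have : ∀ k ∈ Finset.range (entryW (.dot a)), (if k + 1 ∈ Flist (.dot a :: α) then 0 else
            (Finsupp.single (toSeq (expandP [(DEntry.dot a, c)] ++ expandP P2) (k + 1)) 1 : ℕ →₀ ℕ))
            = if k = a then 0 else Finsupp.single c 1 := by
          intro k hk
          have h1 := hF k hk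
          rw [Finset.mem_range] at hk
          have h2 := toSeq_mem (expandP [(DEntry.dot a, c)]) (k + 1) (by omega) (by omega)
          rw [mem_expandP] at h2
          simp at h2
          rw [toSeq_append_left _ _ _ (by omega), h2]
          apply if_congr _ rfl rfl
          rw [h1, hW]; simp [DEntry.isDot]
        rw [Finset.sum_congr rfl this, hW, Finset.sum_range_succ, if_pos rfl, add_zero]
        rw [Finset.sum_congr rfl (g := fun _ => Finsupp.single c 1)]
        · simp [exP, DEntry.val]
        · intro k hk
          rw [Finset.mem_range] at hk
          rw [if_neg (by omega)]
      | undot a =>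
        rw [← sum_expand_undot P1 (fun p hp => h4.1 _ (List.mem_map_of_mem hp)), ← sum_toSeq, hl]
        apply Finset.sum_congr rfl
        intro k hk
        have h1 := hF k hk
        rw [Finset.mem_range] at hk
        rw [if_neg (by rw [h1]; simp [DEntry.isDot]), toSeq_append_left _ _ _ (by omega)]
    · apply Finset.sum_congr rfl
      intro k hk
      rw [add_assoc]
      rw [← hl, toSeq_append_right _ _ _ (by omega), hl]
      apply if_congr _ rfl rfl
      rw [Flist_cons, List.mem_append]
      constructor
      · rintro (h | h)
        · split at h
          · simp at h
          · simp at h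
        · simpa using h
      · intro h; right; simpa using h

lemma fmon_ex (α : DComp) (N : ℕ) (hN : (α.map entryW).sum = N)
    (P : List (DEntry × ℕ)) (h : RefL α (P.map Prod.fst)) :
    (∑ k ∈ (Finset.Icc 1 N).filter (fun k => k ∉ Flist α),
      Finsupp.single (toSeq (expandP P) k) 1) = exP P := by
  rw [← fmon_ex' α P h, hN, Finset.sum_filter, Finset.range_eq_Ico,
    Finset.sum_Ico_add' (fun k => if k ∈ Flist α then 0 else
      Finsupp.single (toSeq (expandP P) k) 1) 0 N 1]
  apply Finset.sum_congr
  · ext k; simp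
  · intro k _
    by_cases hk : k ∈ Flist α <;> simp [hk]

def PairLSet (α : DComp) : Set (List (DEntry × ℕ)) :=
  {P | RefL α (P.map Prod.fst) ∧ (P.map Prod.snd).Pairwise (· < ·) ∧ ∀ c ∈ P.map Prod.snd, 1 ≤ c}

lemma smono_ne_zero (P : List (DEntry × ℕ)) (key : SMonomial)
    (h : smono (thP P) (exP P) key ≠ 0) :
    ∀ c ∈ P.map Prod.snd, c ∈ key.1 ∪ key.2.support := by
  intro c hc
  obtain ⟨⟨e, c⟩, hp, rfl⟩ := List.mem_map.1 hc
  simp only [smono, ne_eq, ite_eq_right_iff, not_forall] at h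
  obtain ⟨⟨_, rfl⟩, _⟩ := h
  rw [Finset.mem_union]
  cases e with
  | dot a =>
    left
    simp only [List.mem_toFinset, thP, List.mem_map, List.mem_filter]
    exact ⟨_, ⟨hp, rfl⟩, rfl⟩
  | undot a =>
    right
    obtain ⟨s, t, rfl⟩ := List.append_of_mem hp
    have := a.pos
    simp [exP_append, exP, DEntry.val]

lemma finite_support (α : DComp) (key : SMonomial) :
    {P | P ∈ PairLSet α ∧ smono (thP P) (exP P) key ≠ 0}.Finite := by
  have hfin : {w : List ℕ | w.length = (α.map entryW).sum ∧
      ∀ c ∈ w, c ∈ key.1 ∪ key.2.support}.Finite := by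
    have h1 := List.finite_length_eq {x // x ∈ key.1 ∪ key.2.support} (α.map entryW).sum
    refine (h1.image (List.map Subtype.val)).subset ?_
    rintro w ⟨h2, h3⟩
    refine ⟨w.attach.map (fun x => ⟨x.1, h3 x.1 x.2⟩), by simpa using h2, ?_⟩
    simp [Function.comp_def]
  refine Set.Finite.of_finite_image (f := expandP) (hfin.subset ?_) ?_
  · rintro _ ⟨P, ⟨⟨h1, h2, h3⟩, h4⟩, rfl⟩
    refine ⟨by rw [length_expandP, sum_entryW_refL h1], fun c hc => ?_⟩
    exact smono_ne_zero P key h4 c ((mem_expandP _ _).1 hc)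
  · rintro P ⟨⟨h1, h2, _⟩, _⟩ Q ⟨⟨h3, h4, _⟩, _⟩ h
    exact expandP_inj α P Q h1 h3 h2 h4 h

def pairMap (P : List (DEntry × ℕ)) : DComp × (ℕ → ℕ) := (P.map Prod.fst, toSeq (P.map Prod.snd))

def pairSet (α : DComp) : Set (DComp × (ℕ → ℕ)) :=
  {q | StrongLe q.1 α ∧ q.2 ∈ SeqSet q.1.length ∧
      ∀ k, 1 ≤ k → k + 1 ≤ q.1.length → q.2 k < q.2 (k + 1)}

lemma pair_bij (α : DComp) : Set.BijOn pairMap (PairLSet α) (pairSet α) := by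
  refine ⟨?_, ?_, ?_⟩
  · rintro P ⟨h1, h2, h3⟩
    refine ⟨strongLe_iff.2 h1, toSeq_mem_SeqSet _ _ (by simp [pairMap]) h3, ?_⟩
    have := (toSeq_chain (· < ·) (P.map Prod.snd)).2 h2
    simpa [pairMap] using this
  · rintro P _ Q _ h
    simp only [pairMap, Prod.mk.injEq] at h
    obtain ⟨h1, h2⟩ := h
    have hl : P.length = Q.length := by simpa using congrArg List.length h1
    have h3 := toSeq_inj _ _ (by simpa using hl) h2
    apply List.ext_getElem hl
    intro k hk hk'
    have a1 : (P.map Prod.fst)[k]'(by simpa using hk) = (Q.map Prod.fst)[k]'(by simpa using hk') := by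
      simp only [h1]
    have a2 : (P.map Prod.snd)[k]'(by simpa using hk) = (Q.map Prod.snd)[k]'(by simpa using hk') := by
      simp only [h3]
    simp only [List.getElem_map] at a1 a2
    exact Prod.ext a1 a2
  · rintro ⟨β, i⟩ ⟨h1, h2, h3⟩
    simp only at h1 h2 h3
    obtain ⟨l, hl, hp, rfl⟩ := exists_toSeq _ i h2
    have e1 : (β.zip l).map Prod.fst = β := List.map_fst_zip (by omega)
    have e2 : (β.zip l).map Prod.snd = l := List.map_snd_zip (by omega)
    refine ⟨β.zip l, ⟨by rw [e1]; exact strongLe_iff.1 h1, ?_, by rw [e2]; exact hp⟩, ?_⟩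
    · rw [e2, ← toSeq_chain]; rw [hl]; exact h3
    · simp only [pairMap, e1, e2]

def seqSetR (α : DComp) (N : ℕ) : Set (ℕ → ℕ) :=
  {i : ℕ → ℕ | i ∈ SeqSet N ∧
          (∀ k, 1 ≤ k → k + 1 ≤ N → i k ≤ i (k + 1)) ∧
          (∀ k ∈ DComp.Dset α, i k < i (k + 1)) ∧
          (∀ k ∈ DComp.Eset α, i k = i (k + 1))}

lemma seq_bij (α : DComp) (N : ℕ) (hN : (α.map entryW).sum = N) :
    Set.BijOn (fun P => toSeq (expandP P)) (PairLSet α) (seqSetR α N) := by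
  refine ⟨?_, ?_, ?_⟩
  · rintro P ⟨h1, h2, h3⟩
    have hl : (expandP P).length = N := by rw [length_expandP, sum_entryW_refL h1, hN]
    have hs := expandP_sorted P h2
    refine ⟨toSeq_mem_SeqSet _ _ hl (fun c hc => h3 c ((mem_expandP _ _).1 hc)), ?_, ?_⟩
    · have := (toSeq_chain (· ≤ ·) (expandP P)).2 hs
      rwa [hl] at this
    · exact (goodW_iff α _ (by rw [hl, hN]) hs).1 (goodW_expandP α P h1 h2)
  · rintro P ⟨h1, h2, _⟩ Q ⟨h3, h4, _⟩ h
    refine expandP_inj α P Q h1 h3 h2 h4 (toSeq_inj _ _ ?_ h)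
    rw [length_expandP, length_expandP, sum_entryW_refL h1, sum_entryW_refL h3]
  · rintro i ⟨h1, h2, h3⟩
    obtain ⟨w, hl, hp, rfl⟩ := exists_toSeq _ i h1
    rw [← hl] at h2
    have hs := (toSeq_chain (· ≤ ·) w).1 h2
    obtain ⟨P, a, b, rfl⟩ := expandP_surj α w hs ((goodW_iff α w (by rw [hl, hN]) hs).2 h3)
    exact ⟨P, ⟨a, b, fun c hc => hp c ((mem_expandP _ _).2 hc)⟩, rfl⟩

noncomputable def pairMono (q : DComp × (ℕ → ℕ)) : SRing :=
  smono (((List.range q.1.length).filter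
          (fun k => (q.1.getD k (DEntry.undot 1)).isDot)).map (fun k => q.2 (k + 1)))
      (∑ k ∈ Finset.range q.1.length,
        Finsupp.single (q.2 (k + 1)) ((q.1.getD k (DEntry.undot 1)).val))

lemma pairMono_pairMap (P : List (DEntry × ℕ)) : pairMono (pairMap P) = smono (thP P) (exP P) := by
  simp only [pairMono, pairMap]
  rw [mono_th, mono_ex]

lemma fundR_eq (α : DComp) (key : SMonomial) :
    FundR α key = ∑ᶠ P ∈ PairLSet α, smono (thP P) (exP P) key := by
  rw [finsum_mem_eq_of_bijOn (g := fun q => pairMono q key) pairMap (pair_bij α)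
    (fun P _ => by rw [pairMono_pairMap])]
  rw [finsum_mem_def, finsum_curry]
  · unfold FundR
    rw [finsum_mem_def]
    apply finsum_congr
    intro β
    by_cases hβ : StrongLe β α
    · rw [Set.indicator_of_mem (by exact hβ)]
      unfold MonoR formalSum
      rw [finsum_mem_def]
      apply finsum_congr
      intro i
      by_cases hi : (β, i) ∈ pairSet α
      · rw [Set.indicator_of_mem hi, Set.indicator_of_mem (by exact hi.2)]
        rfl
      · rw [Set.indicator_of_notMem hi, Set.indicator_of_notMem]
        exact fun h => hi ⟨hβ, h⟩
    · rw [Set.indicator_of_notMem (by exact hβ)]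
      symm
      apply finsum_eq_zero_of_forall_eq_zero
      intro i
      apply Set.indicator_of_notMem
      exact fun h => hβ h.1
  · refine ((finite_support α key).image pairMap).subset ?_
    intro q hq
    have h1 := Set.mem_of_indicator_ne_zero hq
    obtain ⟨P, hP, rfl⟩ := (pair_bij α).2.2 h1
    refine ⟨P, ⟨hP, ?_⟩, rfl⟩
    rw [Function.mem_support, Set.indicator_of_mem h1, pairMono_pairMap] at hq
    exact hq

/-- For `α ⊢ (n, m)`,
`L_α = ∑ (∏_{j∈F(α)} θ_{i_j} x_{i_j}^{−1}) x_{i_1} ⋯ x_{i_{n+m}}`, the sum being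
over all weakly increasing sequences `i_1 ≤ ⋯ ≤ i_{n+m}` of positive integers with
`i_k < i_{k+1}` whenever `k ∈ D(α)` and `i_k = i_{k+1}` whenever `k ∈ E(α)`. -/
theorem fundR_eq_formalSum (α : DComp) (n m : ℕ)
    (hn : DComp.deg α = n) (hm : DComp.fdeg α = m) :
    FundR α =
      formalSum {i : ℕ → ℕ | i ∈ SeqSet (n + m) ∧
          (∀ k, 1 ≤ k → k + 1 ≤ n + m → i k ≤ i (k + 1)) ∧
          (∀ k ∈ DComp.Dset α, i k < i (k + 1)) ∧
          (∀ k ∈ DComp.Eset α, i k = i (k + 1))}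
        (fun i => fmonomial α (n + m) i) := by
  funext key
  have hN : (α.map DComp.entryW).sum = n + m := by rw [total_eq, hn, hm]
  rw [fundR_eq]
  refine finsum_mem_eq_of_bijOn (fun P => toSeq (expandP P)) (seq_bij α (n + m) hN) ?_
  intro P hP
  simp only [fmonomial]
  rw [fmon_th α P hP.1, fmon_ex α _ hN P hP.1]
end

section
/- Let α ⊢ (n,m) be a dotted composition. Then, in the ring R, M_α = Σ (∏_{j∈F(α)} θ_{i_j} x_{i_j}^{−1}) x_{i_1}⋯x_{i_{n+m}}, where the sum is over all weakly increasing sequences i_1 ≤ i_2 ≤ … ≤ i_{n+m} of positive integers such that i_k < i_{k+1} if and only if k ∈ D(α); here (∏_{j∈F(α)} θ_{i_j} x_{i_j}^{−1}) x_{i_1}⋯x_{i_{n+m}} denotes the monomial obtained from x_{i_1}⋯x_{i_{n+m}} by replacing the factor x_{i_j} by θ_{i_j} for each j ∈ F(α), the θ-factors written in increasing order of j. -/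
namespace DCompAux

open DComp

lemma entryW_pos (e : DEntry) : 0 < entryW e := by
  cases e with
  | undot a => simp [entryW, DEntry.val, DEntry.isDot]
  | dot a => simp [entryW, DEntry.val, DEntry.isDot]

lemma psum_zero (α : DComp) : psum α 0 = 0 := by simp [psum]

lemma psum_succ (α : DComp) (k : ℕ) (hk : k < α.length) :
    psum α (k + 1) = psum α k + entryW (α.getD k (DEntry.undot 1)) := by
  unfold psum
  rw [List.take_add_one]
  simp [hk]

lemma psum_len (α : DComp) : psum α α.length = deg α + fdeg α := by
  unfold psum deg fdeg
  rw [List.take_length]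
  induction α with
  | nil => simp
  | cons e t ih =>
    cases e <;> simp [entryW, DEntry.val, DEntry.isDot] at ih ⊢ <;> omega

lemma psum_lt (α : DComp) (k : ℕ) (hk : k < α.length) : psum α k < psum α (k + 1) := by
  rw [psum_succ α k hk]
  have := entryW_pos (α.getD k (DEntry.undot 1))
  omega

lemma psum_mono (α : DComp) {a b : ℕ} (h : a ≤ b) (hb : b ≤ α.length) :
    psum α a ≤ psum α b := by
  induction b, h using Nat.le_induction with
  | base => exact le_rfl
  | succ b hab ih =>
    have := psum_lt α b (by omega)
    have := ih (by omega)
    omega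

lemma psum_strict (α : DComp) {a b : ℕ} (h : a < b) (hb : b ≤ α.length) :
    psum α a < psum α b := by
  have h1 := psum_lt α a (by omega)
  have h2 := psum_mono α (a := a + 1) (b := b) h hb
  omega

lemma block_exists (α : DComp) (j : ℕ) (hj : 1 ≤ j) (L : ℕ) (hL : L ≤ α.length)
    (hN : j ≤ psum α L) :
    ∃ k, k < L ∧ psum α k < j ∧ j ≤ psum α (k + 1) := by
  induction L with
  | zero => rw [psum_zero] at hN; omega
  | succ L ih =>
    by_cases h : j ≤ psum α L
    · obtain ⟨k, hk, h1⟩ := ih (by omega) h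
      exact ⟨k, by omega, h1⟩
    · exact ⟨L, by omega, by omega, hN⟩

lemma block_unique (α : DComp) {j a b : ℕ} (ha : a < α.length) (hb : b < α.length)
    (ha1 : psum α a < j) (ha2 : j ≤ psum α (a + 1))
    (hb1 : psum α b < j) (hb2 : j ≤ psum α (b + 1)) : a = b := by
  rcases lt_trichotomy a b with h | h | h
  · have := psum_mono α (a := a + 1) (b := b) h (by omega)
    omega
  · exact h
  · have := psum_mono α (a := b + 1) (b := a) h (by omega)
    omega

lemma not_mem_D (α : DComp) {j a : ℕ} (ha : a < α.length)
    (ha1 : psum α a < j) (ha2 : j < psum α (a + 1)) : j ∉ Dset α := by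
  rintro ⟨i, hi, hil, rfl⟩
  obtain ⟨c, rfl⟩ : ∃ c, i = c + 1 := ⟨i - 1, by omega⟩
  have := block_unique α ha (by omega : c < α.length) ha1 ha2.le (psum_lt α c (by omega)) le_rfl
  subst this
  omega

lemma mem_Flist (α : DComp) {j a : ℕ} (ha : a < α.length)
    (ha1 : psum α a < j) (ha2 : j ≤ psum α (a + 1)) :
    j ∈ Flist α ↔ ((α.getD a (DEntry.undot 1)).isDot = true ∧ j = psum α (a + 1)) := by
  unfold Flist
  rw [List.mem_map]
  constructor
  · rintro ⟨c, hc, rfl⟩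
    rw [List.mem_filter, List.mem_range] at hc
    have := block_unique α ha hc.1 ha1 ha2 (psum_lt α c hc.1) le_rfl
    subst this
    exact ⟨hc.2, rfl⟩
  · rintro ⟨h, rfl⟩
    exact ⟨a, by rw [List.mem_filter, List.mem_range]; exact ⟨ha, h⟩, rfl⟩

/-- The index set on the right. -/
def T (α : DComp) (N : ℕ) : Set (ℕ → ℕ) :=
  {i : ℕ → ℕ | i ∈ SeqSet N ∧
          (∀ k, 1 ≤ k → k + 1 ≤ N → i k ≤ i (k + 1)) ∧
          (∀ k, 1 ≤ k → k + 1 ≤ N → (i k < i (k + 1) ↔ k ∈ DComp.Dset α))}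

lemma const_block (α : DComp) (i : ℕ → ℕ) (hi : i ∈ T α (psum α α.length)) {a : ℕ}
    (ha : a < α.length) (d : ℕ) : ∀ j, psum α a < j → j + d = psum α (a + 1) →
    i j = i (psum α (a + 1)) := by
  induction d with
  | zero => intro j _ h; rw [← h]; rfl
  | succ d ih =>
    intro j h1 h2
    rw [← ih (j + 1) (by omega) (by omega)]
    have hN := psum_mono α (a := a + 1) (b := α.length) ha le_rfl
    have h3 := hi.2.1 j (by omega) (by omega)
    have h4 := hi.2.2 j (by omega) (by omega)
    have h5 := not_mem_D α ha h1 (by omega : j < psum α (a + 1))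
    have h6 : ¬ i j < i (j + 1) := fun h => h5 (h4.1 h)
    omega

lemma const_block' (α : DComp) (i : ℕ → ℕ) (hi : i ∈ T α (psum α α.length)) {a j : ℕ}
    (ha : a < α.length) (h1 : psum α a < j) (h2 : j ≤ psum α (a + 1)) :
    i j = i (psum α (a + 1)) :=
  const_block α i hi ha (psum α (a + 1) - j) j h1 (by omega)

lemma block_sum (α : DComp) (i : ℕ → ℕ) (hi : i ∈ T α (psum α α.length)) {a : ℕ}
    (ha : a < α.length) :
    (∑ j ∈ Finset.Ioc (psum α a) (psum α (a + 1)),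
      if j ∉ Flist α then (Finsupp.single (i j) 1 : ℕ →₀ ℕ) else 0) =
    Finsupp.single (i (psum α (a + 1))) ((α.getD a (DEntry.undot 1)).val) := by
  have hs := psum_succ α a ha
  unfold entryW at hs
  by_cases hd : (α.getD a (DEntry.undot 1)).isDot = true
  · rw [if_pos hd] at hs
    set v := (α.getD a (DEntry.undot 1)).val with hv
    have hs' : psum α (a + 1) = (psum α a + v) + 1 := by omega
    have : ∑ j ∈ Finset.Ioc (psum α a) (psum α (a + 1)),
        (if j ∉ Flist α then (Finsupp.single (i j) 1 : ℕ →₀ ℕ) else 0)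
        = ∑ j ∈ Finset.Ioc (psum α a) (psum α a + v),
          (Finsupp.single (i (psum α (a + 1))) 1 : ℕ →₀ ℕ) := by
      conv_lhs => rw [hs']
      rw [Finset.sum_Ioc_succ_top (by omega), if_neg, add_zero]
      · apply Finset.sum_congr rfl
        intro j hj
        rw [Finset.mem_Ioc] at hj
        rw [if_pos, const_block' α i hi ha hj.1 (by omega)]
        rw [mem_Flist α ha hj.1 (by omega)]
        omega
      · rw [not_not, mem_Flist α ha (by omega) (by omega)]
        exact ⟨hd, hs'.symm⟩
    rw [this, Finset.sum_const, Nat.card_Ioc]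
    simp
  · rw [if_neg hd] at hs
    have : ∑ j ∈ Finset.Ioc (psum α a) (psum α (a + 1)),
        (if j ∉ Flist α then (Finsupp.single (i j) 1 : ℕ →₀ ℕ) else 0)
        = ∑ j ∈ Finset.Ioc (psum α a) (psum α (a + 1)),
          (Finsupp.single (i (psum α (a + 1))) 1 : ℕ →₀ ℕ) := by
      apply Finset.sum_congr rfl
      intro j hj
      rw [Finset.mem_Ioc] at hj
      rw [if_pos, const_block' α i hi ha hj.1 hj.2]
      rw [mem_Flist α ha hj.1 hj.2]
      exact fun h => hd h.1
    rw [this, Finset.sum_const, Nat.card_Ioc]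
    rw [show psum α (a + 1) - psum α a = (α.getD a (DEntry.undot 1)).val by omega]
    simp

lemma total_sum (α : DComp) (i : ℕ → ℕ) (hi : i ∈ T α (psum α α.length)) (L : ℕ)
    (hL : L ≤ α.length) :
    (∑ j ∈ Finset.Ioc 0 (psum α L),
      if j ∉ Flist α then (Finsupp.single (i j) 1 : ℕ →₀ ℕ) else 0) =
    ∑ k ∈ Finset.range L,
      Finsupp.single (i (psum α (k + 1))) ((α.getD k (DEntry.undot 1)).val) := by
  induction L with
  | zero => simp [psum_zero]
  | succ L ih =>
    rw [Finset.sum_range_succ, ← ih (by omega), ← block_sum α i hi (by omega : L < α.length),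
      Finset.sum_Ioc_consecutive _ (Nat.zero_le _) (psum_lt α L (by omega)).le]

/-- Restriction of a sequence to block ends. -/
def restr (α : DComp) (i : ℕ → ℕ) : ℕ → ℕ :=
  fun k => if 1 ≤ k ∧ k ≤ α.length then i (psum α k) else 0

lemma restr_succ (α : DComp) (i : ℕ → ℕ) {k : ℕ} (hk : k < α.length) :
    restr α i (k + 1) = i (psum α (k + 1)) := by
  unfold restr
  rw [if_pos ⟨by omega, by omega⟩]

/-- The index set on the left. -/
def S (α : DComp) : Set (ℕ → ℕ) := {i : ℕ → ℕ | i ∈ SeqSet α.length ∧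
      ∀ k, 1 ≤ k → k + 1 ≤ α.length → i k < i (k + 1)}

lemma restr_mapsTo (α : DComp) : Set.MapsTo (restr α) (T α (psum α α.length)) (S α) := by
  intro i hi
  refine ⟨⟨?_, ?_⟩, ?_⟩
  · intro k h1 h2
    unfold restr
    rw [if_pos ⟨h1, h2⟩]
    apply hi.1.1 _ _ (psum_mono α h2 le_rfl)
    have := psum_strict α (a := 0) (b := k) h1 h2
    omega
  · intro k hk
    unfold restr
    rw [if_neg (by omega)]
  · intro k h1 h2
    unfold restr
    rw [if_pos ⟨h1, by omega⟩, if_pos ⟨by omega, h2⟩]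
    have h3 := psum_lt α k h2
    have h4 := psum_mono α (a := k + 1) (b := α.length) h2 le_rfl
    have h5 := psum_strict α (a := 0) (b := k) h1 (by omega)
    rw [← const_block' α i hi (j := psum α k + 1) (by omega) (by omega) (by omega)]
    exact (hi.2.2 _ (by omega) (by omega)).2 ⟨k, h1, h2, rfl⟩

lemma restr_injOn (α : DComp) : Set.InjOn (restr α) (T α (psum α α.length)) := by
  intro i hi i' hi' h
  funext j
  by_cases hj : j = 0 ∨ psum α α.length < j
  · rw [hi.1.2 j hj, hi'.1.2 j hj]
  · obtain ⟨a, ha, h1, h2⟩ := block_exists α j (by omega) α.length le_rfl (by omega)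
    rw [const_block' α i hi ha h1 h2, const_block' α i' hi' ha h1 h2,
      ← restr_succ α i ha, ← restr_succ α i' ha, h]

lemma restr_surjOn (α : DComp) : Set.SurjOn (restr α) (T α (psum α α.length)) (S α) := by
  intro s hs
  have hb : ∀ j, ∃ a, 1 ≤ j ∧ j ≤ psum α α.length →
      a < α.length ∧ psum α a < j ∧ j ≤ psum α (a + 1) := by
    intro j
    by_cases hj : 1 ≤ j ∧ j ≤ psum α α.length
    · obtain ⟨a, ha⟩ := block_exists α j hj.1 α.length le_rfl hj.2
      exact ⟨a, fun _ => ha⟩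
    · exact ⟨0, fun h => absurd h hj⟩
  choose b hb using hb
  have hval : ∃ i : ℕ → ℕ, (∀ j, (j = 0 ∨ psum α α.length < j) → i j = 0) ∧
      ∀ j a, a < α.length → psum α a < j → j ≤ psum α (a + 1) → i j = s (a + 1) := by
    refine ⟨fun j => if 1 ≤ j ∧ j ≤ psum α α.length then s (b j + 1) else 0, ?_, ?_⟩
    · intro j hj
      exact if_neg (by omega)
    · intro j a ha h1 h2
      have h3 := psum_mono α (a := a + 1) (b := α.length) ha le_rfl
      have hj : 1 ≤ j ∧ j ≤ psum α α.length := by omega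
      have h4 := hb j hj
      have := block_unique α ha h4.1 h1 h2 h4.2.1 h4.2.2
      simp only [if_pos hj, ← this]
  obtain ⟨i, hi0, hi⟩ := hval
  have key : ∀ j, 1 ≤ j → j + 1 ≤ psum α α.length →
      (i j = i (j + 1) ∧ j ∉ Dset α) ∨ (i j < i (j + 1) ∧ j ∈ Dset α) := by
    intro j h1 h2
    obtain ⟨a, ha, h3, h4⟩ := block_exists α j h1 α.length le_rfl (by omega)
    rcases Nat.lt_or_ge j (psum α (a + 1)) with h | h
    · left
      rw [hi j a ha h3 h4, hi (j + 1) a ha (by omega) (by omega)]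
      exact ⟨rfl, not_mem_D α ha h3 h⟩
    · right
      have hj : j = psum α (a + 1) := by omega
      have hal : a + 1 < α.length := by
        by_contra hc
        have : a + 1 = α.length := by omega
        rw [this] at hj
        omega
      have := psum_lt α (a + 1) hal
      rw [hi j a ha h3 h4, hi (j + 1) (a + 1) hal (by omega) (by omega)]
      exact ⟨hs.2 (a + 1) (by omega) hal, a + 1, by omega, hal, hj⟩
  refine ⟨i, ⟨⟨?_, hi0⟩, ?_, ?_⟩, ?_⟩
  · intro j h1 h2
    obtain ⟨a, ha, h3, h4⟩ := block_exists α j h1 α.length le_rfl h2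
    rw [hi j a ha h3 h4]
    exact hs.1.1 _ (by omega) ha
  · intro j h1 h2
    rcases key j h1 h2 with h | h
    · exact h.1.le
    · exact h.1.le
  · intro j h1 h2
    rcases key j h1 h2 with h | h
    · exact ⟨fun h' => absurd h' (by omega), fun h' => absurd h' h.2⟩
    · exact ⟨fun _ => h.2, fun _ => h.1⟩
  · funext k
    by_cases hk : 1 ≤ k ∧ k ≤ α.length
    · obtain ⟨c, rfl⟩ : ∃ c, k = c + 1 := ⟨k - 1, by omega⟩
      rw [restr_succ α i hk.2]
      exact hi _ c hk.2 (psum_lt α c hk.2) le_rfl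
    · unfold restr
      rw [if_neg hk, hs.1.2 k (by omega)]

end DCompAux

/-- For `α ⊢ (n, m)`,
`M_α = ∑ (∏_{j∈F(α)} θ_{i_j} x_{i_j}^{−1}) x_{i_1} ⋯ x_{i_{n+m}}`, the sum being
over all weakly increasing sequences `i_1 ≤ ⋯ ≤ i_{n+m}` of positive integers with
`i_k < i_{k+1}` if and only if `k ∈ D(α)`. -/
theorem monoR_eq_formalSum (α : DComp) (n m : ℕ)
    (hn : DComp.deg α = n) (hm : DComp.fdeg α = m) :
    MonoR α =
      formalSum {i : ℕ → ℕ | i ∈ SeqSet (n + m) ∧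
          (∀ k, 1 ≤ k → k + 1 ≤ n + m → i k ≤ i (k + 1)) ∧
          (∀ k, 1 ≤ k → k + 1 ≤ n + m → (i k < i (k + 1) ↔ k ∈ DComp.Dset α))}
        (fun i => fmonomial α (n + m) i) := by
  subst hn hm
  rw [← DCompAux.psum_len]
  funext key
  unfold MonoR formalSum
  symm
  refine finsum_mem_eq_of_bijOn (DCompAux.restr α)
    ⟨DCompAux.restr_mapsTo α, DCompAux.restr_injOn α, DCompAux.restr_surjOn α⟩ ?_
  intro i hi
  have h1 : (Flist α).map i = ((List.range α.length).filter
          (fun k => (α.getD k (DEntry.undot 1)).isDot)).map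
            (fun k => DCompAux.restr α i (k + 1)) := by
    unfold Flist
    rw [List.map_map]
    apply List.map_congr_left
    intro k hk
    rw [List.mem_filter, List.mem_range] at hk
    rw [DCompAux.restr_succ α i hk.1]
    rfl
  have h2 : (∑ k ∈ (Finset.Icc 1 (DComp.psum α α.length)).filter (fun k => k ∉ Flist α),
      (Finsupp.single (i k) 1 : ℕ →₀ ℕ)) = ∑ k ∈ Finset.range α.length,
        Finsupp.single (DCompAux.restr α i (k + 1)) ((α.getD k (DEntry.undot 1)).val) := by
    rw [Finset.sum_filter]
    refine (DCompAux.total_sum α i hi α.length le_rfl).trans ?_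
    apply Finset.sum_congr rfl
    intro k hk
    rw [Finset.mem_range] at hk
    rw [DCompAux.restr_succ α i hk]
  unfold fmonomial
  beta_reduce
  rw [h1, h2]
end

section
/- Let α and β be dotted compositions with the same total degree and the same fermionic degree. Then β ⪯ α if and only if D(α) ⊆ D(β), E(α) = E(β), and F(α) = F(β). -/
namespace DAux
open DComp

def tot : DComp → ℕ
  | [] => 0
  | e :: α => entryW e + tot α

def RD : DComp → ℕ → ℕ → Prop
  | [], _, _ => False
  | e :: α, s, d => d = s + entryW e ∨ RD α (s + entryW e) d

def RE : DComp → ℕ → ℕ → Prop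
  | [], _, _ => False
  | e :: α, s, d => (e.isDot = true ∧ s < d ∧ d < s + entryW e) ∨ RE α (s + entryW e) d

def RF : DComp → ℕ → ℕ → Prop
  | [], _, _ => False
  | e :: α, s, d => (e.isDot = true ∧ d = s + entryW e) ∨ RF α (s + entryW e) d

lemma w_pos (e : DEntry) : 0 < entryW e := by
  cases e with
  | undot a => simpa [entryW, DEntry.val, DEntry.isDot] using a.pos
  | dot a => simp [entryW, DEntry.isDot]

lemma RD_gt (α : DComp) : ∀ s d, RD α s d → s < d := by
  induction α with
  | nil => intro s d h; exact h.elim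
  | cons e α ih =>
    intro s d h
    have := w_pos e
    rcases h with h | h
    · omega
    · have := ih _ _ h; omega

lemma RE_gt (α : DComp) : ∀ s d, RE α s d → s < d := by
  induction α with
  | nil => intro s d h; exact h.elim
  | cons e α ih =>
    intro s d h
    have := w_pos e
    rcases h with h | h
    · omega
    · have := ih _ _ h; omega

lemma RF_gt (α : DComp) : ∀ s d, RF α s d → s < d := by
  induction α with
  | nil => intro s d h; exact h.elim
  | cons e α ih =>
    intro s d h
    have := w_pos e
    rcases h with h | h
    · omega
    · have := ih _ _ h; omega

lemma RD_le (α : DComp) : ∀ s d, RD α s d → d ≤ s + tot α := by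
  induction α with
  | nil => intro s d h; exact h.elim
  | cons e α ih =>
    intro s d h
    simp only [tot]
    rcases h with h | h
    · omega
    · have := ih _ _ h; omega

lemma RD_tot (α : DComp) : ∀ s, α ≠ [] → RD α s (s + tot α) := by
  induction α with
  | nil => intro s h; exact (h rfl).elim
  | cons e α ih =>
    intro s _
    by_cases h : α = []
    · subst h; left; simp [tot]
    · right
      have := ih (s + entryW e) h
      simpa [tot, add_assoc] using this

lemma psum_zero (α : DComp) : psum α 0 = 0 := by simp [psum]
lemma psum_cons (e : DEntry) (α : DComp) (i : ℕ) :
    psum (e :: α) (i + 1) = entryW e + psum α i := by simp [psum]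

lemma tot_pos (α : DComp) : 0 < tot α ↔ 0 < α.length := by
  cases α with
  | nil => simp [tot]
  | cons e α => have := w_pos e; simp [tot]; omega

lemma D_iff (α : DComp) : ∀ s d, (∃ i, 1 ≤ i ∧ i < α.length ∧ d = s + psum α i) ↔
    RD α s d ∧ d < s + tot α := by
  induction α with
  | nil => intro s d; simp [RD]
  | cons e α ih =>
    intro s d
    have ih' := ih (s + entryW e) d
    have ht := tot_pos α
    constructor
    · rintro ⟨i, h1, h2, h3⟩
      obtain ⟨k, rfl⟩ : ∃ k, i = k + 1 := ⟨i - 1, by omega⟩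
      rw [psum_cons] at h3
      simp only [List.length_cons] at h2
      rcases Nat.eq_zero_or_pos k with rfl | hk
      · rw [psum_zero] at h3
        refine ⟨Or.inl (by omega), ?_⟩
        have := ht.2 (by omega)
        simp only [tot]; omega
      · have := ih'.1 ⟨k, hk, by omega, by omega⟩
        exact ⟨Or.inr this.1, by simp only [tot]; omega⟩
    · rintro ⟨h | h, h2⟩
      · simp only [tot] at h2
        have := ht.1 (by omega)
        exact ⟨1, le_rfl, by simp only [List.length_cons]; omega,
          by rw [psum_cons, psum_zero]; omega⟩
      · simp only [tot] at h2
        obtain ⟨k, h1, h3, h4⟩ := ih'.2 ⟨h, by omega⟩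
        exact ⟨k + 1, by omega, by simp only [List.length_cons]; omega,
          by rw [psum_cons]; omega⟩

lemma E_iff (α : DComp) : ∀ s j, (∃ k, k < α.length ∧
    (α.getD k (DEntry.undot 1)).isDot = true ∧ s + psum α k < j ∧ j < s + psum α (k + 1)) ↔
    RE α s j := by
  induction α with
  | nil => intro s d; simp [RE]
  | cons e α ih =>
    intro s j
    have ih' := ih (s + entryW e) j
    constructor
    · rintro ⟨k, h1, h2, h3, h4⟩
      rw [psum_cons] at h4
      cases k with
      | zero =>
        rw [psum_zero] at h3 h4
        exact Or.inl ⟨by simpa using h2, by omega, by omega⟩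
      | succ k =>
        rw [psum_cons] at h3
        exact Or.inr (ih'.1 ⟨k, by simpa using h1, by simpa using h2, by omega, by omega⟩)
    · rintro (⟨h1, h2, h3⟩ | h)
      · exact ⟨0, by simp, by simpa using h1, by rw [psum_zero]; omega,
          by rw [psum_cons, psum_zero]; omega⟩
      · obtain ⟨k, h1, h2, h3, h4⟩ := ih'.2 h
        exact ⟨k + 1, by simpa using h1, by simpa using h2, by rw [psum_cons]; omega,
          by rw [psum_cons]; omega⟩

lemma F_iff (α : DComp) : ∀ s j, (∃ k, k < α.length ∧
    (α.getD k (DEntry.undot 1)).isDot = true ∧ j = s + psum α (k + 1)) ↔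
    RF α s j := by
  induction α with
  | nil => intro s d; simp [RF]
  | cons e α ih =>
    intro s j
    have ih' := ih (s + entryW e) j
    constructor
    · rintro ⟨k, h1, h2, h4⟩
      rw [psum_cons] at h4
      cases k with
      | zero =>
        rw [psum_zero] at h4
        exact Or.inl ⟨by simpa using h2, by omega⟩
      | succ k =>
        exact Or.inr (ih'.1 ⟨k, by simpa using h1, by simpa using h2, by omega⟩)
    · rintro (⟨h1, h3⟩ | h)
      · exact ⟨0, by simp, by simpa using h1, by rw [psum_cons, psum_zero]; omega⟩
      · obtain ⟨k, h1, h2, h4⟩ := ih'.2 h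
        exact ⟨k + 1, by simpa using h1, by simpa using h2, by rw [psum_cons]; omega⟩

def P (α β : DComp) (s : ℕ) : Prop :=
  tot α = tot β ∧ (∀ d, RD α s d → RD β s d) ∧ (∀ d, RE α s d ↔ RE β s d) ∧
    (∀ d, RF α s d ↔ RF β s d)

lemma P_cons (e : DEntry) (α β : DComp) (s : ℕ) :
    P (e :: α) (e :: β) s ↔ P α β (s + entryW e) := by
  constructor
  · rintro ⟨h1, h2, h3, h4⟩
    refine ⟨by simpa [tot] using h1, fun d hd => ?_, fun d => ⟨fun hd => ?_, fun hd => ?_⟩,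
      fun d => ⟨fun hd => ?_, fun hd => ?_⟩⟩
    · have := RD_gt _ _ _ hd
      rcases h2 d (Or.inr hd) with h | h
      · omega
      · exact h
    · have := RE_gt _ _ _ hd
      rcases (h3 d).1 (Or.inr hd) with h | h
      · omega
      · exact h
    · have := RE_gt _ _ _ hd
      rcases (h3 d).2 (Or.inr hd) with h | h
      · omega
      · exact h
    · have := RF_gt _ _ _ hd
      rcases (h4 d).1 (Or.inr hd) with h | h
      · omega
      · exact h
    · have := RF_gt _ _ _ hd
      rcases (h4 d).2 (Or.inr hd) with h | h
      · omega
      · exact h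
  · rintro ⟨h1, h2, h3, h4⟩
    refine ⟨by simpa [tot] using h1, fun d => Or.imp_right (h2 d), fun d => or_congr_right (h3 d),
      fun d => or_congr_right (h4 d)⟩

lemma w_undot (a : ℕ+) : entryW (DEntry.undot a) = a := by
  simp [entryW, DEntry.val, DEntry.isDot]

lemma P_merge (a b : ℕ+) (r : DComp) (s : ℕ) :
    P (DEntry.undot (a + b) :: r) (DEntry.undot a :: DEntry.undot b :: r) s := by
  refine ⟨?_, ?_, ?_, ?_⟩
  · simp [tot, w_undot, add_assoc]
  · intro d; simp only [RD, w_undot, PNat.add_coe, add_assoc]; tauto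
  · intro d; simp [RE, w_undot, DEntry.isDot, add_assoc]
  · intro d; simp [RF, w_undot, DEntry.isDot, add_assoc]

lemma P_cover {β α : DComp} (h : StrongCover β α) : ∀ s, P α β s := by
  obtain ⟨l, r, a, b, rfl, rfl⟩ := h
  induction l with
  | nil => intro s; exact P_merge a b r s
  | cons e l ih => intro s; exact (P_cons e _ _ s).2 (ih _)

lemma P_le {β α : DComp} (h : StrongLe β α) (s : ℕ) : P α β s := by
  induction h with
  | refl => exact ⟨rfl, fun _ h => h, fun _ => Iff.rfl, fun _ => Iff.rfl⟩
  | tail _ h2 ih =>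
    obtain ⟨a1, a2, a3, a4⟩ := P_cover h2 s
    obtain ⟨b1, b2, b3, b4⟩ := ih
    exact ⟨a1.trans b1, fun d h => b2 d (a2 d h), fun d => (a3 d).trans (b3 d),
      fun d => (a4 d).trans (b4 d)⟩

lemma le_cons (e : DEntry) {β α : DComp} (h : StrongLe β α) : StrongLe (e :: β) (e :: α) := by
  induction h with
  | refl => exact Relation.ReflTransGen.refl
  | tail _ h2 ih =>
    obtain ⟨l, r, a, b, rfl, rfl⟩ := h2
    exact Relation.ReflTransGen.tail ih ⟨e :: l, r, a, b, rfl, rfl⟩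

lemma entry_ext {a b : DEntry} (h : entryW a = entryW b) (h' : a.isDot = true ↔ b.isDot = true) :
    a = b := by
  cases a <;> cases b <;> simp_all [entryW, DEntry.val, DEntry.isDot]

lemma le_of_P (β : DComp) : ∀ α s, P α β s → StrongLe β α := by
  induction β with
  | nil =>
    intro α s h
    cases α with
    | nil => exact Relation.ReflTransGen.refl
    | cons a α => exact (h.2.1 _ (Or.inl rfl)).elim
  | cons b β ih =>
    intro α s h
    cases α with
    | nil =>
      have h1 := h.1
      have := w_pos b
      simp only [tot] at h1; omega
    | cons a α =>
      have hle : entryW b ≤ entryW a := by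
        rcases h.2.1 _ (Or.inl rfl) with h | h
        · omega
        · have := RD_gt _ _ _ h; omega
      rcases hle.eq_or_lt with heq | hlt
      · have hab : a = b := by
          refine entry_ext heq.symm ⟨fun ha => ?_, fun hb => ?_⟩
          · rcases (h.2.2.2 _).1 (Or.inl ⟨ha, rfl⟩) with h | h
            · exact h.1
            · have := RF_gt _ _ _ h; omega
          · rcases (h.2.2.2 _).2 (Or.inl ⟨hb, rfl⟩) with h | h
            · exact h.1
            · have := RF_gt _ _ _ h; omega
        subst hab
        exact le_cons a (ih _ _ ((P_cons a α β s).1 h))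
      · have hb0 := w_pos b
        cases a with
        | dot a =>
          exfalso
          rcases (h.2.2.1 (s + entryW b)).1 (Or.inl ⟨rfl, by omega, by omega⟩) with h | h
          · omega
          · have := RE_gt _ _ _ h; omega
        | undot a =>
          cases b with
          | dot b =>
            exfalso
            rcases (h.2.2.2 _).2 (Or.inl ⟨rfl, rfl⟩) with h | h
            · omega
            · have := RF_gt _ _ _ h; omega
          | undot b =>
            rw [w_undot, w_undot] at hlt
            obtain ⟨c, rfl⟩ : ∃ c, a = b + c := by
              exact ⟨a - b, (PNat.add_sub_of_lt (PNat.coe_lt_coe _ _ |>.1 hlt)).symm⟩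
            have hP : P (DEntry.undot b :: DEntry.undot c :: α) (DEntry.undot b :: β) s := by
              obtain ⟨a1, a2, a3, a4⟩ := P_merge b c α s
              obtain ⟨b1, b2, b3, b4⟩ := h
              refine ⟨a1.symm.trans b1, fun d hd => ?_, fun d => (a3 d).symm.trans (b3 d),
                fun d => (a4 d).symm.trans (b4 d)⟩
              rcases hd with hd | hd | hd
              · exact Or.inl hd
              · apply b2; left; simp only [w_undot, PNat.add_coe] at hd ⊢; omega
              · apply b2; right
                simpa only [w_undot, PNat.add_coe, add_assoc] using hd
            have h1 := le_cons (DEntry.undot b) (ih _ _ ((P_cons _ _ _ s).1 hP))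
            exact Relation.ReflTransGen.tail h1 ⟨[], α, b, c, rfl, rfl⟩

lemma tot_eq (α : DComp) : tot α = deg α + fdeg α := by
  induction α with
  | nil => simp [tot, deg, fdeg]
  | cons e α ih =>
    cases e <;> simp [tot, ih, deg, fdeg, entryW, DEntry.val, DEntry.isDot] <;> omega

lemma P_iff (α β : DComp) (ht : tot α = tot β) :
    P α β 0 ↔ Dset α ⊆ Dset β ∧ Eset α = Eset β ∧ Fset α = Fset β := by
  have hD : ∀ γ d, d ∈ Dset γ ↔ RD γ 0 d ∧ d < tot γ := fun γ d => by
    simpa [Dset] using D_iff γ 0 d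
  have hE : ∀ γ d, d ∈ Eset γ ↔ RE γ 0 d := fun γ d => by
    simpa [Eset] using E_iff γ 0 d
  have hF : ∀ γ d, d ∈ Fset γ ↔ RF γ 0 d := fun γ d => by
    simpa [Fset] using F_iff γ 0 d
  simp only [P, Set.ext_iff, Set.subset_def, hD, hE, hF, ht, true_and]
  refine and_congr_left fun _ => ⟨fun h d hd => ⟨h d hd.1, hd.2⟩, fun h d hd => ?_⟩
  have hle := RD_le _ _ _ hd
  have hgt := RD_gt _ _ _ hd
  rcases lt_or_eq_of_le hle with hl | hl
  · exact (h d ⟨hd, by omega⟩).1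
  · have hne : β ≠ [] := by
      rintro rfl
      simp only [tot] at ht; omega
    have := RD_tot β 0 hne
    rw [hl, ht]; exact this

end DAux

/-- For dotted compositions `α`, `β` of the same total degree and
the same fermionic degree, `β ⪯ α ↔ D(α) ⊆ D(β), E(α) = E(β), F(α) = F(β)`. -/
theorem strongLe_iff_sets (α β : DComp)
    (hdeg : DComp.deg α = DComp.deg β) (hfdeg : DComp.fdeg α = DComp.fdeg β) :
    DComp.StrongLe β α ↔
      DComp.Dset α ⊆ DComp.Dset β ∧ DComp.Eset α = DComp.Eset β ∧
        DComp.Fset α = DComp.Fset β := by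
  have ht : DAux.tot α = DAux.tot β := by
    rw [DAux.tot_eq, DAux.tot_eq, hdeg, hfdeg]
  rw [← DAux.P_iff α β ht]
  exact ⟨fun h => DAux.P_le h 0, DAux.le_of_P β α 0⟩
end

section
/- Let α and β be dotted compositions with the same total degree and the same fermionic degree. Then β ⪯ α if and only if D(α) ⊆ D(β), D(β) ∩ E(α) = ∅, and F(α) = F(β). -/
namespace DCompAux
open DComp

def W (α : DComp) : ℕ := (α.map entryW).sum

def Pset (α : DComp) : Set ℕ := {d | ∃ i, i ≤ α.length ∧ d = psum α i}

lemma psum_cons (x : DEntry) (t : DComp) (i : ℕ) :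
    psum (x :: t) (i + 1) = entryW x + psum t i := by simp [psum]

lemma psum_length (α : DComp) : psum α α.length = W α := by simp [psum, W]

lemma W_cons (x : DEntry) (t : DComp) : W (x :: t) = entryW x + W t := by simp [W]

lemma W_nil : W [] = 0 := by simp [W]

lemma W_eq (α : DComp) : W α = deg α + fdeg α := by
  induction α with
  | nil => simp [W, deg, fdeg]
  | cons x t ih =>
    rw [W_cons, ih]
    cases x <;> simp [deg, fdeg, entryW, DEntry.val, DEntry.isDot] <;> ring

lemma mem_P_nil (d : ℕ) : d ∈ Pset [] ↔ d = 0 := by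
  simp [Pset, psum]

lemma mem_P_cons (x : DEntry) (t : DComp) (d : ℕ) :
    d ∈ Pset (x :: t) ↔ d = 0 ∨ ∃ m ∈ Pset t, d = entryW x + m := by
  constructor
  · rintro ⟨i, hi, rfl⟩
    cases i with
    | zero => left; exact psum_zero _
    | succ i =>
      right
      exact ⟨psum t i, ⟨i, by simpa using hi, rfl⟩, psum_cons _ _ _⟩
  · rintro (rfl | ⟨m, ⟨i, hi, rfl⟩, rfl⟩)
    · exact ⟨0, by simp, (psum_zero _).symm⟩
    · exact ⟨i + 1, by simpa using hi, (psum_cons _ _ _).symm⟩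

lemma zero_mem_P (α : DComp) : 0 ∈ Pset α := ⟨0, by simp, (psum_zero _).symm⟩

lemma W_mem_P (α : DComp) : W α ∈ Pset α := ⟨α.length, le_rfl, (psum_length _).symm⟩

lemma mem_E_nil (d : ℕ) : ¬ d ∈ Eset [] := by simp [Eset]
lemma mem_F_nil (d : ℕ) : ¬ d ∈ Fset [] := by simp [Fset]

lemma mem_E_cons (x : DEntry) (t : DComp) (d : ℕ) :
    d ∈ Eset (x :: t) ↔ (x.isDot = true ∧ 0 < d ∧ d < entryW x) ∨
      ∃ m ∈ Eset t, d = entryW x + m := by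
  constructor
  · rintro ⟨i, hi, h1, h2, h3⟩
    cases i with
    | zero =>
      left
      rw [psum_zero] at h2
      rw [psum_cons, psum_zero] at h3
      exact ⟨by simpa using h1, h2, by simpa using h3⟩
    | succ i =>
      right
      rw [psum_cons] at h2 h3
      refine ⟨d - entryW x, ⟨i, by simpa using hi, by simpa using h1, ?_, ?_⟩, ?_⟩ <;> omega
  · rintro (⟨h1, h2, h3⟩ | ⟨m, ⟨i, hi, h1, h2, h3⟩, rfl⟩)
    · refine ⟨0, by simp, by simpa using h1, ?_, ?_⟩
      · rw [psum_zero]; exact h2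
      · rw [psum_cons, psum_zero]; exact h3
    · refine ⟨i + 1, by simpa using hi, by simpa using h1, ?_, ?_⟩
      · rw [psum_cons]; omega
      · rw [psum_cons]; omega

lemma mem_F_cons (x : DEntry) (t : DComp) (d : ℕ) :
    d ∈ Fset (x :: t) ↔ (x.isDot = true ∧ d = entryW x) ∨
      ∃ m ∈ Fset t, d = entryW x + m := by
  constructor
  · rintro ⟨i, hi, h1, h2⟩
    cases i with
    | zero =>
      left
      rw [psum_cons, psum_zero] at h2
      exact ⟨by simpa using h1, h2⟩
    | succ i =>
      right
      rw [psum_cons] at h2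
      exact ⟨_, ⟨i, by simpa using hi, by simpa using h1, rfl⟩, h2⟩
  · rintro (⟨h1, h2⟩ | ⟨m, ⟨i, hi, h1, h2⟩, rfl⟩)
    · refine ⟨0, by simp, by simpa using h1, ?_⟩
      rw [psum_cons, psum_zero]; exact h2
    · refine ⟨i + 1, by simpa using hi, by simpa using h1, ?_⟩
      rw [psum_cons, h2]

lemma F_pos (α : DComp) (d : ℕ) (h : d ∈ Fset α) : 0 < d := by
  cases α with
  | nil => exact absurd h (mem_F_nil d)
  | cons x t =>
    have := entryW_pos x
    rcases (mem_F_cons x t d).1 h with ⟨_, rfl⟩ | ⟨m, _, rfl⟩ <;> omega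

lemma E_bd (α : DComp) (d : ℕ) (h : d ∈ Eset α) : 0 < d ∧ d < W α := by
  induction α generalizing d with
  | nil => exact absurd h (mem_E_nil d)
  | cons x t ih =>
    have := entryW_pos x
    rw [W_cons]
    rcases (mem_E_cons x t d).1 h with ⟨_, h1, h2⟩ | ⟨m, hm, rfl⟩
    · omega
    · have := ih m hm
      omega

lemma mem_D (α : DComp) (d : ℕ) : d ∈ Dset α ↔ d ∈ Pset α ∧ 0 < d ∧ d < W α := by
  induction α generalizing d with
  | nil => simp [Dset, W]
  | cons x t ih =>
    have hx := entryW_pos x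
    rw [mem_P_cons, W_cons]
    constructor
    · rintro ⟨i, h1, h2, rfl⟩
      obtain ⟨i, rfl⟩ : ∃ k, i = k + 1 := ⟨i - 1, by omega⟩
      have h2 : i < t.length := by simpa using h2
      rw [psum_cons]
      refine ⟨Or.inr ⟨_, ⟨i, h2.le, rfl⟩, rfl⟩, by omega, ?_⟩
      cases i with
      | zero =>
        rw [psum_zero]
        cases t with
        | nil => simp at h2
        | cons y s => have := entryW_pos y; rw [W_cons]; omega
      | succ i =>
        have := ((ih _).1 ⟨i + 1, by omega, h2, rfl⟩).2.2
        omega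
    · rintro ⟨rfl | ⟨m, ⟨i, hi, rfl⟩, rfl⟩, h1, h2⟩
      · omega
      · refine ⟨i + 1, by omega, ?_, (psum_cons _ _ _).symm⟩
        rcases hi.lt_or_eq with h | h
        · simpa using h
        · rw [h, psum_length] at h2; omega

lemma P_E_disj (α : DComp) (d : ℕ) (h : d ∈ Pset α) : d ∉ Eset α := by
  induction α generalizing d with
  | nil => exact mem_E_nil d
  | cons x t ih =>
    have hx := entryW_pos x
    rw [mem_E_cons]
    rw [mem_P_cons] at h
    rintro (⟨_, h1, h2⟩ | ⟨m, hm, rfl⟩)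
    · rcases h with rfl | ⟨m, _, rfl⟩ <;> omega
    · rcases h with h | ⟨m', hm', h⟩
      · omega
      · obtain rfl : m = m' := by omega
        exact ih _ hm' hm

lemma cons_le (x : DEntry) {β α : DComp} (h : StrongLe β α) : StrongLe (x :: β) (x :: α) := by
  induction h with
  | refl => exact Relation.ReflTransGen.refl
  | tail _ hc ih =>
    refine Relation.ReflTransGen.tail ih ?_
    obtain ⟨l, r, a, b, rfl, rfl⟩ := hc
    exact ⟨x :: l, r, a, b, by simp, by simp⟩

lemma entryW_undot (a : ℕ+) : entryW (DEntry.undot a) = a := by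
  simp [entryW, DEntry.val, DEntry.isDot]

lemma entryW_dot (a : ℕ) : entryW (DEntry.dot a) = a + 1 := by
  simp [entryW, DEntry.val, DEntry.isDot]

lemma isDot_undot (a : ℕ+) : (DEntry.undot a).isDot = false := rfl

lemma split_E (a b : ℕ+) (r : DComp) (d : ℕ) :
    d ∈ Eset (DEntry.undot a :: DEntry.undot b :: r) ↔ d ∈ Eset (DEntry.undot (a + b) :: r) := by
  simp only [mem_E_cons, isDot_undot, entryW_undot, PNat.add_coe, Bool.false_eq_true, false_and,
    false_or]
  constructor
  · rintro ⟨_, ⟨m, hm, rfl⟩, rfl⟩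
    exact ⟨m, hm, by omega⟩
  · rintro ⟨m, hm, rfl⟩
    exact ⟨_, ⟨m, hm, rfl⟩, by omega⟩

lemma split_F (a b : ℕ+) (r : DComp) (d : ℕ) :
    d ∈ Fset (DEntry.undot a :: DEntry.undot b :: r) ↔ d ∈ Fset (DEntry.undot (a + b) :: r) := by
  simp only [mem_F_cons, isDot_undot, entryW_undot, PNat.add_coe, Bool.false_eq_true, false_and,
    false_or]
  constructor
  · rintro ⟨_, ⟨m, hm, rfl⟩, rfl⟩
    exact ⟨m, hm, by omega⟩
  · rintro ⟨m, hm, rfl⟩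
    exact ⟨_, ⟨m, hm, rfl⟩, by omega⟩

lemma cover_sets (l r : DComp) (a b : ℕ+) (d : ℕ) :
    (d ∈ Eset (l ++ DEntry.undot a :: DEntry.undot b :: r) ↔
      d ∈ Eset (l ++ DEntry.undot (a + b) :: r)) ∧
    (d ∈ Fset (l ++ DEntry.undot a :: DEntry.undot b :: r) ↔
      d ∈ Fset (l ++ DEntry.undot (a + b) :: r)) ∧
    (d ∈ Pset (l ++ DEntry.undot (a + b) :: r) →
      d ∈ Pset (l ++ DEntry.undot a :: DEntry.undot b :: r)) := by
  induction l generalizing d with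
  | nil =>
    refine ⟨split_E a b r d, split_F a b r d, ?_⟩
    simp only [List.nil_append, mem_P_cons, entryW_undot, PNat.add_coe]
    rintro (rfl | ⟨m, hm, rfl⟩)
    · exact Or.inl rfl
    · exact Or.inr ⟨_, Or.inr ⟨m, hm, rfl⟩, by omega⟩
  | cons x t ih =>
    simp only [List.cons_append, mem_P_cons, mem_E_cons, mem_F_cons]
    refine ⟨?_, ?_, ?_⟩
    · simp only [fun d => (ih d).1]
    · simp only [fun d => (ih d).2.1]
    · rintro (rfl | ⟨m, hm, rfl⟩)
      · exact Or.inl rfl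
      · exact Or.inr ⟨m, (ih m).2.2 hm, rfl⟩

lemma le_sets {β α : DComp} (h : StrongLe β α) :
    Eset β = Eset α ∧ Fset β = Fset α ∧ Pset α ⊆ Pset β := by
  induction h with
  | refl => exact ⟨rfl, rfl, subset_rfl⟩
  | tail _ hc ih =>
    obtain ⟨l, r, a, b, rfl, rfl⟩ := hc
    obtain ⟨h1, h2, h3⟩ := ih
    refine ⟨h1.trans (Set.ext fun d => (cover_sets l r a b d).1),
      h2.trans (Set.ext fun d => (cover_sets l r a b d).2.1), fun d hd => h3 ?_⟩
    exact (cover_sets l r a b d).2.2 hd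

lemma eq_of_W {x y : DEntry} (h : entryW x = entryW y) (h' : x.isDot = true ↔ y.isDot = true) :
    x = y := by
  cases x <;> cases y <;> simp_all [DEntry.isDot, entryW_undot, entryW_dot]

/-- Stripping a common first entry. -/
lemma tails {y : DEntry} {s t : DComp}
    (hW : W (y :: s) = W (y :: t)) (hP : Pset (y :: s) ⊆ Pset (y :: t))
    (hE : ∀ d ∈ Pset (y :: t), d ∉ Eset (y :: s))
    (hF : ∀ d, d ∈ Fset (y :: s) ↔ d ∈ Fset (y :: t)) :
    W s = W t ∧ Pset s ⊆ Pset t ∧ (∀ d ∈ Pset t, d ∉ Eset s) ∧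
      (∀ d, d ∈ Fset s ↔ d ∈ Fset t) := by
  have hy := entryW_pos y
  have aux : ∀ u v : DComp, (∀ d, d ∈ Fset (y :: u) → d ∈ Fset (y :: v)) →
      ∀ d, d ∈ Fset u → d ∈ Fset v := by
    intro u v h d hd
    have hp := F_pos _ _ hd
    rcases (mem_F_cons _ _ _).1 (h _ ((mem_F_cons _ _ _).2 (Or.inr ⟨d, hd, rfl⟩))) with
      ⟨_, h1⟩ | ⟨m, hm, h1⟩
    · omega
    · obtain rfl : d = m := by omega
      exact hm
  refine ⟨by simpa [W_cons] using hW, ?_, ?_, ?_⟩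
  · intro d hd
    rcases (mem_P_cons _ _ _).1 (hP ((mem_P_cons _ _ _).2 (Or.inr ⟨d, hd, rfl⟩))) with
      h1 | ⟨m, hm, h1⟩
    · omega
    · obtain rfl : d = m := by omega
      exact hm
  · intro d hd hd'
    exact hE _ ((mem_P_cons _ _ _).2 (Or.inr ⟨d, hd, rfl⟩))
      ((mem_E_cons _ _ _).2 (Or.inr ⟨d, hd', rfl⟩))
  · exact fun d => ⟨aux s t (fun d => (hF d).1) d, aux t s (fun d => (hF d).2) d⟩

lemma W_eq_zero {α : DComp} (h : W α = 0) : α = [] := by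
  cases α with
  | nil => rfl
  | cons x t => have := entryW_pos x; rw [W_cons] at h; omega

lemma dot_head {x y : DEntry} {s t : DComp} (hy : y.isDot = true) (hle : entryW y ≤ entryW x)
    (h : ∀ d, d ∈ Fset (y :: t) → d ∈ Fset (x :: s)) :
    x.isDot = true ∧ entryW y = entryW x := by
  rcases (mem_F_cons _ _ _).1 (h _ ((mem_F_cons _ _ _).2 (Or.inl ⟨hy, rfl⟩))) with
    h1 | ⟨m, hm, h1⟩
  · exact h1
  · have := F_pos _ _ hm
    omega

lemma backward (β : DComp) : ∀ α : DComp, W α = W β → Pset α ⊆ Pset β →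
    (∀ d ∈ Pset β, d ∉ Eset α) → (∀ d, d ∈ Fset α ↔ d ∈ Fset β) → StrongLe β α := by
  induction β with
  | nil =>
    intro α hW _ _ _
    rw [W_eq_zero (hW.trans W_nil)]
    exact Relation.ReflTransGen.refl
  | cons y t ih =>
    intro α hW hP hE hF
    have hy := entryW_pos y
    cases α with
    | nil => rw [W_nil, W_cons] at hW; omega
    | cons x s =>
      have hx := entryW_pos x
      have hle : entryW y ≤ entryW x := by
        have : entryW x ∈ Pset (y :: t) :=
          hP ((mem_P_cons _ _ _).2 (Or.inr ⟨0, zero_mem_P _, rfl⟩))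
        rcases (mem_P_cons _ _ _).1 this with h | ⟨m, _, h⟩ <;> omega
      rcases hle.eq_or_lt with heq | hlt
      · obtain rfl : y = x := by
          refine eq_of_W heq ⟨fun h => ?_, fun h => ?_⟩
          · exact (dot_head h hle fun d => (hF d).2).1
          · exact (dot_head h heq.ge fun d => (hF d).1).1
        obtain ⟨h1, h2, h3, h4⟩ := tails hW hP hE hF
        exact cons_le _ (ih s h1 h2 h3 h4)
      · have hyP : entryW y ∈ Pset (y :: t) :=
          (mem_P_cons _ _ _).2 (Or.inr ⟨0, zero_mem_P _, rfl⟩)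
        have hxd : ¬ x.isDot = true := fun h =>
          hE _ hyP ((mem_E_cons _ _ _).2 (Or.inl ⟨h, hy, hlt⟩))
        have hyd : ¬ y.isDot = true := fun h => by
          have := (dot_head h hle fun d => (hF d).2).2
          omega
        cases x with
        | dot a => exact absurd rfl hxd
        | undot a =>
          cases y with
          | dot b => exact absurd rfl hyd
          | undot b =>
            rw [entryW_undot, entryW_undot] at hlt
            obtain ⟨c, rfl⟩ : ∃ c : ℕ+, a = b + c :=
              ⟨a - b, (PNat.add_sub_of_lt (by exact_mod_cast hlt)).symm⟩
            have hc : StrongCover (DEntry.undot b :: DEntry.undot c :: s)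
                (DEntry.undot (b + c) :: s) := ⟨[], s, b, c, rfl, rfl⟩
            refine Relation.ReflTransGen.tail (cons_le _ (ih _ ?_ ?_ ?_ ?_)) hc
            all_goals
              have key := @tails (DEntry.undot b) (DEntry.undot c :: s) t
                (by rw [← hW]; simp only [W_cons, entryW_undot, PNat.add_coe]; ring)
                (by
                  intro d hd
                  rcases (mem_P_cons _ _ _).1 hd with rfl | ⟨m, hm, rfl⟩
                  · exact zero_mem_P _
                  · rcases (mem_P_cons _ _ _).1 hm with rfl | ⟨m, hm2, rfl⟩
                    · exact hyP
                    · refine hP ((mem_P_cons _ _ _).2 (Or.inr ⟨m, hm2, ?_⟩))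
                      simp only [entryW_undot, PNat.add_coe]; ring)
                (fun d hd h => hE d hd ((split_E b c s d).1 h))
                (fun d => (split_F b c s d).trans (hF d))
            · exact key.1
            · exact key.2.1
            · exact key.2.2.1
            · exact key.2.2.2

end DCompAux

/-- For dotted compositions `α`, `β` of the same total degree and
the same fermionic degree,
`β ⪯ α ↔ D(α) ⊆ D(β), D(β) ∩ E(α) = ∅, F(α) = F(β)`. -/
theorem strongLe_iff_sets' (α β : DComp)
    (hdeg : DComp.deg α = DComp.deg β) (hfdeg : DComp.fdeg α = DComp.fdeg β) :
    DComp.StrongLe β α ↔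
      DComp.Dset α ⊆ DComp.Dset β ∧ DComp.Dset β ∩ DComp.Eset α = ∅ ∧
        DComp.Fset α = DComp.Fset β := by
  open DCompAux in
  have hW : W α = W β := by rw [W_eq, W_eq, hdeg, hfdeg]
  constructor
  · intro h
    obtain ⟨h1, h2, h3⟩ := DCompAux.le_sets h
    refine ⟨fun d hd => ?_, ?_, h2.symm⟩
    · rw [DCompAux.mem_D] at hd ⊢
      exact ⟨h3 hd.1, hd.2.1, hW ▸ hd.2.2⟩
    · rw [← h1, Set.eq_empty_iff_forall_notMem]
      rintro d ⟨hd, hd'⟩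
      exact DCompAux.P_E_disj β d ((DCompAux.mem_D _ _).1 hd).1 hd'
  · rintro ⟨h1, h2, h3⟩
    refine DCompAux.backward β α hW ?_ ?_ ?_
    · intro d hd
      by_cases h0 : d = 0
      · rw [h0]; exact DCompAux.zero_mem_P _
      by_cases hw : d = DCompAux.W α
      · rw [hw, hW]; exact DCompAux.W_mem_P _
      have hle : d ≤ DCompAux.W α := by
        obtain ⟨i, hi, rfl⟩ := hd
        rcases hi.lt_or_eq with h | h
        · have hi0 : i ≠ 0 := by rintro rfl; exact h0 (DCompAux.psum_zero _)
          exact ((DCompAux.mem_D α _).1 ⟨i, by omega, h, rfl⟩).2.2.le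
        · rw [h, DCompAux.psum_length]
      exact ((DCompAux.mem_D _ _).1 (h1 ((DCompAux.mem_D _ _).2
        ⟨hd, by omega, by omega⟩))).1
    · intro d hd hd'
      have := DCompAux.E_bd _ _ hd'
      exact Set.eq_empty_iff_forall_notMem.1 h2 d
        ⟨(DCompAux.mem_D _ _).2 ⟨hd, this.1, hW ▸ this.2⟩, hd'⟩
    · intro d; rw [h3]
end
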